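/- arXiv:2407.07272 — 2 statements merged into one kernel-verified Lean document; each statement's English description precedes it below -/
import Mathlib

section
/- Let G be a spray on a nonempty open set U ⊆ ℝ² (n = 2). Then for every volume form dV on U the Berwald–Weyl curvature of (G,dV) is given by W^o_k = R_{|k} − ½ R_{·k|m} y^m − (1/3) χ_{k|m} y^m, where R is the Ricci scalar and χ_k the χ-curvature of G and '|' is taken with respect to G; in particular, W^o_k does not depend on the choice of dV. -/
open scoped BigOperators
open MeasureTheory

noncomputable section BerwaldWeyl

/-- Points/vectors in local coordinates on `ℝⁿ`. -/
abbrev Vec (n : ℕ) := Fin n → ℝ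

/-- Partial derivative in the base (`x`) variable along the `i`-th coordinate. -/
def pdx {n : ℕ} (f : Vec n → Vec n → ℝ) (i : Fin n) : Vec n → Vec n → ℝ :=
  fun x y => fderiv ℝ (fun x' => f x' y) x (Pi.single i 1)

/-- Vertical derivative `f_{·i} = ∂f/∂y^i`. -/
def pdy {n : ℕ} (f : Vec n → Vec n → ℝ) (i : Fin n) : Vec n → Vec n → ℝ :=
  fun x y => fderiv ℝ (fun y' => f x y') y (Pi.single i 1)

/-- The slit fiber `ℝⁿ \ {0}`. -/
def slit (n : ℕ) : Set (Vec n) := {y | y ≠ 0}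

/-- A spray on `U ⊆ ℝⁿ`: a family `G^i(x,y)`, smooth on `U × (ℝⁿ \ {0})` and
positively 2-homogeneous in `y`. -/
def IsSpray {n : ℕ} (U : Set (Vec n)) (G : Fin n → Vec n → Vec n → ℝ) : Prop :=
  (∀ i, ContDiffOn ℝ (⊤ : ℕ∞) (fun p : Vec n × Vec n => G i p.1 p.2) (U ×ˢ slit n)) ∧
  (∀ i, ∀ x ∈ U, ∀ y ∈ slit n, ∀ c : ℝ, 0 < c → G i x (c • y) = c ^ 2 * G i x y)

/-- Nonlinear connection coefficients `N^i_j := ∂G^i/∂y^j`. -/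
def Nc {n : ℕ} (G : Fin n → Vec n → Vec n → ℝ) (i j : Fin n) : Vec n → Vec n → ℝ :=
  pdy (G i) j

/-- Berwald connection coefficients `Γ^i_{jk} := ∂²G^i/∂y^j∂y^k`. -/
def Γc {n : ℕ} (G : Fin n → Vec n → Vec n → ℝ) (i j k : Fin n) : Vec n → Vec n → ℝ :=
  pdy (pdy (G i) j) k

/-- Horizontal derivative of a scalar: `f_{|k} := δf/δx^k = ∂f/∂x^k - N^l_k ∂f/∂y^l`. -/
def hD {n : ℕ} (G : Fin n → Vec n → Vec n → ℝ) (f : Vec n → Vec n → ℝ) (k : Fin n) :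
    Vec n → Vec n → ℝ :=
  fun x y => pdx f k x y - ∑ l, Nc G l k x y * pdy f l x y

/-- Horizontal covariant derivative `A_{j|m}` of a 1-form `A_j`. -/
def covD1 {n : ℕ} (G : Fin n → Vec n → Vec n → ℝ) (A : Fin n → Vec n → Vec n → ℝ)
    (j m : Fin n) : Vec n → Vec n → ℝ :=
  fun x y => hD G (A j) m x y - ∑ l, A l x y * Γc G l j m x y

/-- Horizontal covariant derivative `A^i_{j|m}` of a (1,1)-tensor `A^i_j`. -/
def covD11 {n : ℕ} (G : Fin n → Vec n → Vec n → ℝ)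
    (A : Fin n → Fin n → Vec n → Vec n → ℝ) (i j m : Fin n) : Vec n → Vec n → ℝ :=
  fun x y => hD G (A i j) m x y + ∑ l, A l j x y * Γc G i l m x y
    - ∑ l, A i l x y * Γc G l j m x y

/-- Horizontal covariant derivative `B^i_{jk|m}` of a (1,2)-tensor `B^i_{jk}`. -/
def covD12 {n : ℕ} (G : Fin n → Vec n → Vec n → ℝ)
    (B : Fin n → Fin n → Fin n → Vec n → Vec n → ℝ) (i j k m : Fin n) : Vec n → Vec n → ℝ :=
  fun x y => hD G (B i j k) m x y + ∑ l, B l j k x y * Γc G i l m x y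
    - ∑ l, B i l k x y * Γc G l j m x y - ∑ l, B i j l x y * Γc G l k m x y

/-- Riemann curvature `R^i_k`. -/
def Riem {n : ℕ} (G : Fin n → Vec n → Vec n → ℝ) (i k : Fin n) : Vec n → Vec n → ℝ :=
  fun x y => 2 * pdx (G i) k x y - ∑ j, y j * pdy (pdx (G i) j) k x y
    + 2 * ∑ j, G j x y * Γc G i j k x y - ∑ s, Nc G i s x y * Nc G s k x y

/-- Ricci scalar `R := R^m_m/(n-1)`. -/
def Ricci {n : ℕ} (G : Fin n → Vec n → Vec n → ℝ) : Vec n → Vec n → ℝ :=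
  fun x y => (∑ m, Riem G m m x y) / ((n : ℝ) - 1)

/-- The Weyl-type curvature `T^i_k := R^i_k - (R δ^i_k - ½ R_{·k} y^i)`. -/
def Tcurv {n : ℕ} (G : Fin n → Vec n → Vec n → ℝ) (i k : Fin n) : Vec n → Vec n → ℝ :=
  fun x y => Riem G i k x y -
    (Ricci G x y * (if i = k then 1 else 0) - (1/2) * pdy (Ricci G) k x y * y i)

/-- The χ-curvature `χ_i := -(1/3) T^m_{i·m}`. -/
def chiC {n : ℕ} (G : Fin n → Vec n → Vec n → ℝ) (i : Fin n) : Vec n → Vec n → ℝ :=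
  fun x y => -(1/3) * ∑ m, pdy (Tcurv G m i) m x y

/-- The Weyl curvature `W^i_k := T^i_k + (3χ_k/(n+1)) y^i`. -/
def Weyl {n : ℕ} (G : Fin n → Vec n → Vec n → ℝ) (i k : Fin n) : Vec n → Vec n → ℝ :=
  fun x y => Tcurv G i k x y + (3 * chiC G k x y / ((n : ℝ) + 1)) * y i

/-- A volume form `dV = σ(x) dx` on `U`: `σ` smooth and positive. -/
def IsVolumeForm {n : ℕ} (U : Set (Vec n)) (σ : Vec n → ℝ) : Prop :=
  ContDiffOn ℝ (⊤ : ℕ∞) σ U ∧ ∀ x ∈ U, 0 < σ x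

/-- The S-curvature of `(G, dV)`: `S := ∂G^m/∂y^m - y^m ∂(ln σ)/∂x^m`. -/
def Scurv {n : ℕ} (G : Fin n → Vec n → Vec n → ℝ) (σ : Vec n → ℝ) : Vec n → Vec n → ℝ :=
  fun x y => ∑ m, Nc G m m x y
    - ∑ m, y m * fderiv ℝ (fun x' => Real.log (σ x')) x (Pi.single m 1)

/-- The projective spray `Ĝ^i := G^i - (S/(n+1)) y^i` of `(G, dV)`. -/
def Ghat {n : ℕ} (G : Fin n → Vec n → Vec n → ℝ) (σ : Vec n → ℝ) :
    Fin n → Vec n → Vec n → ℝ :=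
  fun i x y => G i x y - (Scurv G σ x y / ((n : ℝ) + 1)) * y i

/-- The Berwald–Weyl curvature `W^o_k := R̂_{∥k} - ½ R̂_{·k∥m} y^m` of `(G, dV)`,
where all hatted quantities and `∥` are taken with respect to the projective spray `Ĝ`. -/
def BWeyl {n : ℕ} (G : Fin n → Vec n → Vec n → ℝ) (σ : Vec n → ℝ) (k : Fin n) :
    Vec n → Vec n → ℝ :=
  fun x y => hD (Ghat G σ) (Ricci (Ghat G σ)) k x y
    - (1/2) * ∑ m, covD1 (Ghat G σ) (fun j => pdy (Ricci (Ghat G σ)) j) k m x y * y m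


section Calculus

open scoped ContDiff

variable {E : Type*} [NormedAddCommGroup E] [NormedSpace ℝ E]

/-- The algebra of smooth real functions on a subset `V` of a normed space. -/
def smoothAlg (V : Set E) : Subalgebra ℝ (V → ℝ) where
  carrier := {f | ∃ F : E → ℝ, ContDiffOn ℝ ∞ F V ∧ ∀ v : V, F v = f v}
  mul_mem' := by
    rintro _ _ ⟨F, hF, hf⟩ ⟨H, hH, hh⟩
    exact ⟨fun v => F v * H v, hF.mul hH, fun v => by simp [hf, hh]⟩
  add_mem' := by
    rintro _ _ ⟨F, hF, hf⟩ ⟨H, hH, hh⟩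
    exact ⟨fun v => F v + H v, hF.add hH, fun v => by simp [hf, hh]⟩
  algebraMap_mem' r := ⟨fun _ => r, contDiffOn_const, fun _ => rfl⟩

variable {V : Set E}

/-- The element of `smoothAlg V` given by a function that is smooth on `V`. -/
def smoothRestrict (F : E → ℝ) (hF : ContDiffOn ℝ ∞ F V) : smoothAlg V :=
  ⟨fun v => F v, F, hF, fun _ => rfl⟩

/-- A chosen extension of a smooth function on `V` to the ambient space. -/
def smoothLift (f : smoothAlg V) : E → ℝ := f.2.choose

lemma contDiffOn_smoothLift (f : smoothAlg V) : ContDiffOn ℝ ∞ (smoothLift f) V :=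
  f.2.choose_spec.1

lemma smoothLift_apply (f : smoothAlg V) (v : V) : smoothLift f v = f.1 v :=
  f.2.choose_spec.2 v

lemma differentiableAt_smoothLift (hV : IsOpen V) (f : smoothAlg V) (v : V) :
    DifferentiableAt ℝ (smoothLift f) v :=
  ((contDiffOn_smoothLift f).differentiableOn (by simp)).differentiableAt (hV.mem_nhds v.2)

lemma eventuallyEq_smoothLift (hV : IsOpen V) {F : E → ℝ} {f : smoothAlg V}
    (h : ∀ v : V, F v = f.1 v) (v : V) : F =ᶠ[nhds (v : E)] smoothLift f := by
  filter_upwards [hV.mem_nhds v.2] with w hw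
  rw [h ⟨w, hw⟩, smoothLift_apply f ⟨w, hw⟩]

lemma contDiffOn_fderiv_apply (hV : IsOpen V) {F : E → ℝ} (hF : ContDiffOn ℝ ∞ F V) (w : E) :
    ContDiffOn ℝ ∞ (fun v => fderiv ℝ F v w) V :=
  (hF.fderiv_of_isOpen hV (by simp)).clm_apply contDiffOn_const

/-- The directional derivative along `w`, as a derivation of the algebra of smooth functions. -/
def dirDeriv (hV : IsOpen V) (w : E) : Derivation ℝ (smoothAlg V) (smoothAlg V) :=
  Derivation.mk'
    { toFun := fun f => smoothRestrict (fun v => fderiv ℝ (smoothLift f) v w)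
        (contDiffOn_fderiv_apply hV (contDiffOn_smoothLift f) w)
      map_add' := fun f h => by
        refine Subtype.ext (funext fun v => ?_)
        have e := (eventuallyEq_smoothLift hV (F := smoothLift f + smoothLift h) (f := f + h)
          (fun v => by simp [smoothLift_apply]) v).fderiv_eq (𝕜 := ℝ)
        change fderiv ℝ (smoothLift (f + h)) v w =
          fderiv ℝ (smoothLift f) v w + fderiv ℝ (smoothLift h) v w
        rw [← e, fderiv_add (differentiableAt_smoothLift hV f v)
          (differentiableAt_smoothLift hV h v)]
        rfl
      map_smul' := fun r f => by
        refine Subtype.ext (funext fun v => ?_)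
        have e := (eventuallyEq_smoothLift hV (F := r • smoothLift f) (f := r • f)
          (fun v => by simp [smoothLift_apply]) v).fderiv_eq (𝕜 := ℝ)
        change fderiv ℝ (smoothLift (r • f)) v w = r * fderiv ℝ (smoothLift f) v w
        rw [← e, fderiv_const_smul (differentiableAt_smoothLift hV f v)]
        rfl }
    fun f h => by
      refine Subtype.ext (funext fun v => ?_)
      have e := (eventuallyEq_smoothLift hV (F := smoothLift f * smoothLift h) (f := f * h)
        (fun v => by simp [smoothLift_apply]) v).fderiv_eq (𝕜 := ℝ)
      change fderiv ℝ (smoothLift (f * h)) v w =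
        f.1 v * fderiv ℝ (smoothLift h) v w + h.1 v * fderiv ℝ (smoothLift f) v w
      rw [← e, fderiv_mul (differentiableAt_smoothLift hV f v)
        (differentiableAt_smoothLift hV h v), smoothLift_apply, smoothLift_apply]
      rfl

lemma dirDeriv_apply (hV : IsOpen V) (w : E) {F : E → ℝ} {f : smoothAlg V}
    (h : ∀ v : V, F v = f.1 v) (v : V) : (dirDeriv hV w f).1 v = fderiv ℝ F v w := by
  rw [(eventuallyEq_smoothLift hV h v).fderiv_eq]
  rfl

lemma dirDeriv_comm (hV : IsOpen V) (w z : E) (f : smoothAlg V) :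
    dirDeriv hV w (dirDeriv hV z f) = dirDeriv hV z (dirDeriv hV w f) := by
  refine Subtype.ext (funext fun v => ?_)
  have hs := (contDiffOn_smoothLift f).contDiffAt (hV.mem_nhds v.2)
  have hd : DifferentiableAt ℝ (fderiv ℝ (smoothLift f)) v :=
    (hs.fderiv_right (m := 1) (WithTop.coe_le_coe.2 le_top)).differentiableAt (by simp)
  have e (a b : E) : (dirDeriv hV a (dirDeriv hV b f)).1 v =
      fderiv ℝ (fderiv ℝ (smoothLift f)) v a b := by
    rw [dirDeriv_apply hV a (F := fun v => fderiv ℝ (smoothLift f) v b) (fun v => rfl) v,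
      fderiv_clm_apply hd (differentiableAt_const b)]
    simp
  rw [e, e]
  exact (hs.isSymmSndFDerivAt (by
    simpa using WithTop.coe_le_coe.2 (le_top : (2 : ℕ∞) ≤ ⊤))).eq w z

end Calculus

/-- Two pairs of commuting derivations together with fibre coordinates: the algebraic model of
the partial derivatives `∂/∂x^i`, `∂/∂y^i` on smooth functions on a planar slit tangent bundle. -/
structure SlitCalculus (A : Type*) [CommRing A] [Algebra ℝ A] where
  dx : Fin 2 → Derivation ℝ A A
  dy : Fin 2 → Derivation ℝ A A
  y : Fin 2 → A
  dx_dx : ∀ i j f, dx i (dx j f) = dx j (dx i f)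
  dy_dx : ∀ i j f, dy i (dx j f) = dx j (dy i f)
  dy_dy : ∀ i j f, dy i (dy j f) = dy j (dy i f)
  dx_y : ∀ i j, dx i (y j) = 0
  dy_y : ∀ i j, dy i (y j) = if i = j then 1 else 0

namespace SlitCalculus

variable {A : Type*} [CommRing A] [Algebra ℝ A] (c : SlitCalculus A)

/-- Homogeneity of degree `d` in the fibre variable, in Euler's form. -/
def IsHom (d : ℕ) (f : A) : Prop := c.y 0 * c.dy 0 f + c.y 1 * c.dy 1 f = d * f

/-- The derivation `y^j ∂/∂x^j - 2 G^j ∂/∂y^j`. -/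
def sprayField (g : Fin 2 → A) : Derivation ℝ A A :=
  c.y 0 • c.dx 0 + c.y 1 • c.dx 1 - (2 * g 0) • c.dy 0 - (2 * g 1) • c.dy 1

/-- The Riemann curvature, written with the spray field. -/
def riem (g : Fin 2 → A) (i k : Fin 2) : A :=
  2 * c.dx k (g i) - c.sprayField g (c.dy k (g i))
    - (c.dy 0 (g i) * c.dy k (g 0) + c.dy 1 (g i) * c.dy k (g 1))

/-- The Ricci scalar in dimension two. -/
def ricci (g : Fin 2 → A) : A := c.riem g 0 0 + c.riem g 1 1

/-- Twice the curvature `T^i_k`. -/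
def twiceT (g : Fin 2 → A) (i k : Fin 2) : A :=
  2 * c.riem g i k - 2 * (c.ricci g * if i = k then 1 else 0) + c.dy k (c.ricci g) * c.y i

/-- Twice the expression `f_{|k} - ½ f_{·k|m} y^m`, for a 2-homogeneous spray `g`. -/
def twiceB (g : Fin 2 → A) (f : A) (k : Fin 2) : A :=
  2 * c.dx k f - c.sprayField g (c.dy k f)
    - (c.dy k (g 0) * c.dy 0 f + c.dy k (g 1) * c.dy 1 f)

variable {c} {g : Fin 2 → A} {f p : A} {d e : ℕ}

lemma sprayField_apply (f : A) : c.sprayField g f =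
    c.y 0 * c.dx 0 f + c.y 1 * c.dx 1 f - 2 * g 0 * c.dy 0 f - 2 * g 1 * c.dy 1 f := by
  simp [sprayField]

lemma derivation_two (D : Derivation ℝ A A) : D 2 = 0 := by
  simpa using D.map_natCast 2

lemma dy_sprayField (k : Fin 2) (f : A) : c.dy k (c.sprayField g f) =
    c.sprayField g (c.dy k f) + c.dx k f
      - 2 * (c.dy k (g 0) * c.dy 0 f + c.dy k (g 1) * c.dy 1 f) := by
  simp only [sprayField_apply, map_add, map_sub, Derivation.leibniz, derivation_two,
    smul_eq_mul, c.dy_y, c.dy_dx, c.dy_dy k]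
  fin_cases k <;> simp <;> ring

lemma dx_sprayField (k : Fin 2) (f : A) : c.dx k (c.sprayField g f) =
    c.sprayField g (c.dx k f)
      - 2 * (c.dx k (g 0) * c.dy 0 f + c.dx k (g 1) * c.dy 1 f) := by
  simp only [sprayField_apply, map_add, map_sub, Derivation.leibniz, derivation_two,
    smul_eq_mul, c.dx_y, c.dy_dx, c.dx_dx k]
  ring

lemma IsHom.add {f h : A} (hf : c.IsHom d f) (hh : c.IsHom d h) : c.IsHom d (f + h) := by
  simp only [IsHom, map_add] at *
  linear_combination hf + hh

lemma IsHom.sub {f h : A} (hf : c.IsHom d f) (hh : c.IsHom d h) : c.IsHom d (f - h) := by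
  simp only [IsHom, map_sub] at *
  linear_combination hf - hh

lemma IsHom.mul {f h : A} (hf : c.IsHom d f) (hh : c.IsHom e h) : c.IsHom (d + e) (f * h) := by
  simp only [IsHom, Derivation.leibniz, smul_eq_mul, Nat.cast_add] at *
  linear_combination h * hf + f * hh

lemma IsHom.two_mul (hf : c.IsHom d f) : c.IsHom d (2 * f) := by
  rw [_root_.two_mul]
  exact hf.add hf

lemma isHom_y (k : Fin 2) : c.IsHom 1 (c.y k) := by
  fin_cases k <;> simp [IsHom, c.dy_y]

lemma IsHom.dx (hf : c.IsHom d f) (k : Fin 2) : c.IsHom d (c.dx k f) := by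
  have h := congrArg (c.dx k) hf
  simp only [map_add, Derivation.leibniz, smul_eq_mul, c.dx_y, Derivation.map_natCast] at h
  simp only [IsHom, c.dy_dx]
  linear_combination h

lemma IsHom.dy (hf : c.IsHom (d + 1) f) (k : Fin 2) : c.IsHom d (c.dy k f) := by
  have h := congrArg (c.dy k) hf
  simp only [map_add, Derivation.leibniz, smul_eq_mul, c.dy_y, Derivation.map_natCast,
    c.dy_dy k] at h
  push_cast at h
  simp only [IsHom]
  fin_cases k <;> simp at h ⊢ <;> linear_combination h

lemma IsHom.sprayField (hg : ∀ i, c.IsHom 2 (g i)) (hf : c.IsHom (d + 1) f) :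
    c.IsHom (d + 2) (c.sprayField g f) := by
  rw [sprayField_apply, mul_assoc, mul_assoc]
  have hx (k : Fin 2) : c.IsHom (d + 2) (c.y k * c.dx k f) := by
    rw [show d + 2 = 1 + (d + 1) by ring]
    exact (isHom_y k).mul (hf.dx k)
  have hy (k : Fin 2) : c.IsHom (d + 2) (2 * (g k * c.dy k f)) := by
    rw [add_comm]
    exact ((hg k).mul (hf.dy k)).two_mul
  exact (((hx 0).add (hx 1)).sub (hy 0)).sub (hy 1)

lemma isHom_riem (hg : ∀ i, c.IsHom 2 (g i)) (i k : Fin 2) : c.IsHom 2 (c.riem g i k) := by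
  have hN (i k : Fin 2) : c.IsHom 1 (c.dy k (g i)) := (hg i).dy k
  exact (((hg i).dx k).two_mul.sub ((hN i k).sprayField (d := 0) hg)).sub
    (((hN i 0).mul (hN 0 k)).add ((hN i 1).mul (hN 1 k)))

lemma isHom_ricci (hg : ∀ i, c.IsHom 2 (g i)) : c.IsHom 2 (c.ricci g) :=
  (isHom_riem hg 0 0).add (isHom_riem hg 1 1)

/-- The effect of a projective change on the spray field. -/
lemma sprayField_projective (f : A) : c.sprayField (fun i => g i + p * c.y i) f =
    c.sprayField g f - 2 * p * (c.y 0 * c.dy 0 f + c.y 1 * c.dy 1 f) := by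
  simp only [sprayField_apply]
  ring

lemma isHom_projective (hg : ∀ i, c.IsHom 2 (g i)) (hp : c.IsHom 1 p) (i : Fin 2) :
    c.IsHom 2 (g i + p * c.y i) :=
  (hg i).add (hp.mul (isHom_y i))

/-- The effect of a projective change on the Ricci scalar. -/
lemma ricci_projective (hg : ∀ i, c.IsHom 2 (g i)) (hp : c.IsHom 1 p) :
    c.ricci (fun i => g i + p * c.y i) = c.ricci g + (p ^ 2 - c.sprayField g p) := by
  have hN (i k : Fin 2) := (hg i).dy k
  have hP (k : Fin 2) := hp.dy (d := 0) k
  have hg0 := hg 0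
  have hg1 := hg 1
  simp only [IsHom] at hN hP hp hg0 hg1
  simp only [ricci, riem, sprayField_projective]
  simp only [map_add, Derivation.leibniz, smul_eq_mul, c.dy_y, c.dx_y, Fin.isValue,
    ↓reduceIte, one_ne_zero, zero_ne_one, mul_one, mul_zero, zero_add,
    add_zero]
  have e00 := hN 0 0
  have e11 := hN 1 1
  have hP0 := hP 0
  have hP1 := hP 1
  push_cast at e00 e11 hP0 hP1 hp hg0 hg1
  have hS := sprayField_apply (c := c) (g := g) p
  have hS0 := sprayField_apply (c := c) (g := g) (c.y 0)
  have hS1 := sprayField_apply (c := c) (g := g) (c.y 1)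
  simp only [c.dy_y, c.dx_y, Fin.isValue, ↓reduceIte, one_ne_zero, zero_ne_one, mul_one, mul_zero,
    add_zero, sub_zero] at hS0 hS1
  have hX := congrArg (c.sprayField g) hp
  simp only [map_add, Derivation.leibniz, smul_eq_mul, hS0, hS1, one_mul] at hX hp
  simp only [hS0, hS1]
  linear_combination 2 * p * (e00 + e11 + c.y 0 * hP0 + c.y 1 * hP1) - hX - 2 * hS
    - 2 * (c.dy 0 p * hg0 + c.dy 1 p * hg1)
    + (3 * p - (c.y 0 * c.dy 0 p + c.y 1 * c.dy 1 p)) * hp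

/-- The effect of a projective change on `twiceB`. -/
lemma twiceB_projective (hf : c.IsHom 2 f) (k : Fin 2) :
    c.twiceB (fun i => g i + p * c.y i) f k =
      c.twiceB g f k + p * c.dy k f - 2 * f * c.dy k p := by
  have hk := hf.dy k
  simp only [IsHom] at hk hf
  push_cast at hk hf
  simp only [twiceB, sprayField_projective, map_add, Derivation.leibniz, smul_eq_mul, c.dy_y]
  fin_cases k <;> simp at hk ⊢ <;> linear_combination 2 * p * hk - c.dy _ p * hf

/-- In dimension two the Weyl curvature vanishes. -/
lemma weyl_eq_zero (hg : ∀ i, c.IsHom 2 (g i)) (i k : Fin 2) :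
    3 * c.twiceT g i k = (c.dy 0 (c.twiceT g 0 k) + c.dy 1 (c.twiceT g 1 k)) * c.y i := by
  have hR := isHom_ricci hg
  have hT (i k : Fin 2) : c.IsHom 2 (c.twiceT g i k) := by
    have hδ : c.IsHom 0 (if i = k then (1 : A) else 0) := by
      split_ifs <;> simp [IsHom]
    exact ((isHom_riem hg i k).two_mul.sub (hR.mul hδ).two_mul).add ((hR.dy k).mul (isHom_y i))
  have htr : c.twiceT g 0 0 + c.twiceT g 1 1 = 0 := by
    have h := hR
    simp only [IsHom] at h
    push_cast at h
    simp only [twiceT, Fin.isValue, ↓reduceIte]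
    have e : c.ricci g = c.riem g 0 0 + c.riem g 1 1 := rfl
    linear_combination h - 2 * e
  have hann (i : Fin 2) : c.twiceT g i 0 * c.y 0 + c.twiceT g i 1 * c.y 1 = 0 := by
    have h := hR
    have hr : c.riem g i 0 * c.y 0 + c.riem g i 1 * c.y 1 = 0 := by
      have hX := congrArg (c.sprayField g) (hg i)
      have hS := sprayField_apply (c := c) (g := g) (g i)
      have hS0 := sprayField_apply (c := c) (g := g) (c.y 0)
      have hS1 := sprayField_apply (c := c) (g := g) (c.y 1)
      simp only [c.dy_y, c.dx_y, Fin.isValue, ↓reduceIte, one_ne_zero, zero_ne_one, mul_one,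
        mul_zero, add_zero, sub_zero] at hS0 hS1
      simp only [map_add, Derivation.leibniz, smul_eq_mul, hS0, hS1, Derivation.map_natCast] at hX
      have hg0 := hg 0
      have hg1 := hg 1
      simp only [IsHom] at hg0 hg1
      push_cast at hX hg0 hg1
      simp only [riem]
      linear_combination -hX - 2 * hS - c.dy 0 (g i) * hg0 - c.dy 1 (g i) * hg1
    simp only [IsHom] at h
    push_cast at h
    fin_cases i <;> simp [twiceT] at hr ⊢
    · linear_combination 2 * hr + c.y 0 * h
    · linear_combination 2 * hr + c.y 1 * h
  have h11 : c.twiceT g 1 1 = - c.twiceT g 0 0 := by linear_combination htr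
  have hh (j : Fin 2) (i : Fin 2) := congrArg (c.dy j) (hann i)
  have h00 := hT 0 0
  have h01 := hT 0 1
  have h10 := hT 1 0
  have d00 := hh 0 0
  have d01 := hh 0 1
  have d10 := hh 1 0
  have d11 := hh 1 1
  simp only [h11, map_add, map_neg, Derivation.leibniz, smul_eq_mul, c.dy_y, map_zero, IsHom,
    Fin.isValue, ↓reduceIte, one_ne_zero, zero_ne_one] at d00 d01 d10 d11 h00 h01 h10
  push_cast at h00 h01 h10
  fin_cases i <;> fin_cases k <;> simp only [h11, map_neg, Fin.zero_eta, Fin.mk_one, Fin.isValue]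
  · linear_combination -d11 - h00
  · linear_combination d10 - h01
  · linear_combination d01 - h10
  · linear_combination -d00 + h00

/-- The χ-curvature in terms of a multiple `p` of the S-curvature. -/
lemma divergence_twiceT (hg : ∀ i, c.IsHom 2 (g i)) {l : A} (hl : ∀ i, c.dy i l = 0)
    (hS : c.dy 0 (g 0) + c.dy 1 (g 1) - (c.y 0 * c.dx 0 l + c.y 1 * c.dx 1 l) = -3 * p)
    (k : Fin 2) : c.dy 0 (c.twiceT g 0 k) + c.dy 1 (c.twiceT g 1 k) =
      9 * (c.sprayField g (c.dy k p) - c.dx k p) := by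
  have hR := isHom_ricci hg
  have hRk := hR.dy k
  have hL (D : Derivation ℝ A A) (a : A) : D (-3 * a) = -3 * D a := by
    rw [Derivation.leibniz, map_neg, show D 3 = 0 by simpa using D.map_natCast 3]
    simp
  have hx := congrArg (c.dx k) hS
  have hy := congrArg (fun a => c.sprayField g (c.dy k a)) hS
  have hX := sprayField_apply (c := c) (g := g) (c.dx k l)
  simp only [c.dy_dx, hl, map_zero, mul_zero, sub_zero] at hX
  have hdiv : c.dy 0 (c.twiceT g 0 k) + c.dy 1 (c.twiceT g 1 k) =
      2 * (c.dy 0 (c.riem g 0 k) + c.dy 1 (c.riem g 1 k)) + c.dy k (c.ricci g) := by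
    simp only [IsHom] at hRk
    push_cast at hRk
    simp only [twiceT, map_add, map_sub, Derivation.leibniz, smul_eq_mul, c.dy_y, derivation_two]
    fin_cases k <;> simp at hRk ⊢ <;> linear_combination hRk
  have hdiv' : 2 * (c.dy 0 (c.riem g 0 k) + c.dy 1 (c.riem g 1 k)) + c.dy k (c.ricci g) =
      -3 * (c.sprayField g (c.dy k (c.dy 0 (g 0) + c.dy 1 (g 1)))
        - c.dx k (c.dy 0 (g 0) + c.dy 1 (g 1))) := by
    simp only [ricci, riem, map_add, map_sub, Derivation.leibniz, smul_eq_mul, derivation_two,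
      dy_sprayField, c.dy_dx, mul_zero, add_zero]
    fin_cases k <;> simp only [Fin.zero_eta, Fin.mk_one, Fin.isValue, c.dy_dy 1 0] <;> ring
  rw [hdiv, hdiv']
  simp only [hL, map_add, map_sub, Derivation.leibniz, smul_eq_mul, c.dx_y, c.dy_y, c.dy_dx, hl,
    mul_zero, zero_add, add_zero, map_zero, c.dx_dx k] at hx hy
  simp only [map_add]
  fin_cases k <;> simp at hx hy hX ⊢ <;> linear_combination -3 * hy + 3 * hx - 3 * hX

/-- The effect on `twiceB` of the projective change with factor `p`, in dimension two. -/
theorem twiceB_ricci_projective (hg : ∀ i, c.IsHom 2 (g i)) (hp : c.IsHom 1 p) {l : A}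
    (hl : ∀ i, c.dy i l = 0)
    (hS : c.dy 0 (g 0) + c.dy 1 (g 1) - (c.y 0 * c.dx 0 l + c.y 1 * c.dx 1 l) = -3 * p)
    {χ : Fin 2 → A}
    (hχ : ∀ k, 6 * χ k = -(c.dy 0 (c.twiceT g 0 k) + c.dy 1 (c.twiceT g 1 k))) (k : Fin 2) :
    18 * c.twiceB (fun i => g i + p * c.y i) (c.ricci fun i => g i + p * c.y i) k =
      18 * c.twiceB g (c.ricci g) k - 12 * (c.sprayField g (χ k)
        - (c.dy k (g 0) * χ 0 + c.dy k (g 1) * χ 1)) := by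
  have hw (i : Fin 2) := weyl_eq_zero hg i k
  simp only [divergence_twiceT hg hl hS] at hχ hw
  have hR := isHom_ricci hg
  have hΞ : c.IsHom 2 (c.ricci g + (p ^ 2 - c.sprayField g p)) := by
    rw [sq]
    exact hR.add ((hp.mul hp).sub (hp.sprayField (d := 0) hg))
  rw [ricci_projective hg hp, twiceB_projective hΞ]
  have h6 (D : Derivation ℝ A A) (n : ℕ) (a : A) : D (n * a) = n * D a := by
    rw [Derivation.leibniz, Derivation.map_natCast]
    simp
  have hX := congrArg (c.sprayField g) (hχ k)
  have h60 := h6 (c.sprayField g) 6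
  have h69 := h6 (c.sprayField g) 9
  push_cast at h60 h69
  simp only [h60, h69, map_neg, map_sub] at hX
  have hw0 := hw 0
  have hw1 := hw 1
  have hχ0 := hχ 0
  have hχ1 := hχ 1
  simp only [twiceT, riem] at hw0 hw1
  simp only [IsHom] at hp
  push_cast at hp
  simp only [twiceB, sq, map_add, map_sub, Derivation.leibniz, smul_eq_mul, dy_sprayField,
    dx_sprayField, derivation_two]
  fin_cases k <;> simp at hw0 hw1 hX ⊢
  · linear_combination 2 * hX - 2 * (c.dy 0 (g 0) * hχ0 + c.dy 0 (g 1) * hχ1) +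
      6 * (c.dy 0 p * hw0 + c.dy 1 p * hw1) +
      (54 * (c.sprayField g (c.dy 0 p) - c.dx 0 p) - 18 * c.dy 0 (c.ricci g)) * hp
  · linear_combination 2 * hX - 2 * (c.dy 1 (g 0) * hχ0 + c.dy 1 (g 1) * hχ1) +
      6 * (c.dy 0 p * hw0 + c.dy 1 p * hw1) +
      (54 * (c.sprayField g (c.dy 1 p) - c.dx 1 p) - 18 * c.dy 1 (c.ricci g)) * hp

end SlitCalculus

section Bridge

open scoped ContDiff

/-- Evaluation of a smooth function at a point. -/
def evalAt {E : Type*} [NormedAddCommGroup E] [NormedSpace ℝ E] {V : Set E} (v : V) :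
    smoothAlg V →ₐ[ℝ] ℝ :=
  (Pi.evalAlgHom ℝ (fun _ : V => ℝ) v).comp (smoothAlg V).val

lemma smoothAlg_ext {E : Type*} [NormedAddCommGroup E] [NormedSpace ℝ E] {V : Set E}
    {a b : smoothAlg V} (h : ∀ v, evalAt v a = evalAt v b) : a = b :=
  Subtype.ext (funext h)

variable {U : Set (Vec 2)}

lemma isOpen_prod_slit (hU : IsOpen U) : IsOpen (U ×ˢ slit 2) :=
  hU.prod isOpen_ne

lemma fderiv_snd_coord (j : Fin 2) (v : Vec 2 × Vec 2) :
    fderiv ℝ (fun p : Vec 2 × Vec 2 => p.2 j) v =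
      (ContinuousLinearMap.proj j : Vec 2 →L[ℝ] ℝ).comp
        (ContinuousLinearMap.snd ℝ (Vec 2) (Vec 2)) :=
  ContinuousLinearMap.fderiv ((ContinuousLinearMap.proj j : Vec 2 →L[ℝ] ℝ).comp
    (ContinuousLinearMap.snd ℝ (Vec 2) (Vec 2)))

/-- The calculus of smooth functions on `U × (ℝ² \ {0})`. -/
def slitCalculus (hU : IsOpen U) : SlitCalculus (smoothAlg (U ×ˢ slit 2)) where
  dx i := dirDeriv (isOpen_prod_slit hU) (Pi.single i 1, 0)
  dy i := dirDeriv (isOpen_prod_slit hU) (0, Pi.single i 1)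
  y i := smoothRestrict (fun p => p.2 i) (by fun_prop)
  dx_dx _ _ f := dirDeriv_comm _ _ _ f
  dy_dx _ _ f := dirDeriv_comm _ _ _ f
  dy_dy _ _ f := dirDeriv_comm _ _ _ f
  dx_y i j := by
    refine smoothAlg_ext fun v => ?_
    refine (dirDeriv_apply (isOpen_prod_slit hU) _
      (F := fun p : Vec 2 × Vec 2 => p.2 j) (fun _ => rfl) v).trans ?_
    rw [fderiv_snd_coord]
    simp
  dy_y i j := by
    refine smoothAlg_ext fun v => ?_
    refine (dirDeriv_apply (isOpen_prod_slit hU) _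
      (F := fun p : Vec 2 × Vec 2 => p.2 j) (fun _ => rfl) v).trans ?_
    rw [fderiv_snd_coord]
    split_ifs with hij <;> simp [hij, eq_comm]

/-- `F` agrees on `U × (ℝ² \ {0})` with the smooth function `f`. -/
def Represents (F : Vec 2 → Vec 2 → ℝ) (f : smoothAlg (U ×ˢ slit 2)) : Prop :=
  ∀ v : (U ×ˢ slit 2 : Set (Vec 2 × Vec 2)), F v.1.1 v.1.2 = evalAt v f

lemma Represents.differentiableAt (hU : IsOpen U) {F : Vec 2 → Vec 2 → ℝ}
    {f : smoothAlg (U ×ˢ slit 2)} (h : Represents F f)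
    (v : (U ×ˢ slit 2 : Set (Vec 2 × Vec 2))) :
    DifferentiableAt ℝ (fun p : Vec 2 × Vec 2 => F p.1 p.2) v :=
  (differentiableAt_smoothLift (isOpen_prod_slit hU) f v).congr_of_eventuallyEq
    (eventuallyEq_smoothLift (isOpen_prod_slit hU) (F := fun p : Vec 2 × Vec 2 => F p.1 p.2) h v)

lemma Represents.pdx (hU : IsOpen U) {F : Vec 2 → Vec 2 → ℝ} {f : smoothAlg (U ×ˢ slit 2)}
    (h : Represents F f) (i : Fin 2) : Represents (pdx F i) ((slitCalculus hU).dx i f) := by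
  intro v
  refine Eq.trans ?_ (dirDeriv_apply (isOpen_prod_slit hU) _
    (F := fun p : Vec 2 × Vec 2 => F p.1 p.2) h v).symm
  have hc := HasFDerivAt.comp (f := fun x => (x, v.1.2)) v.1.1
    (h.differentiableAt hU v).hasFDerivAt (hasFDerivAt_prodMk_left (𝕜 := ℝ) v.1.1 v.1.2)
  exact congrArg (· (Pi.single i 1)) hc.fderiv

lemma Represents.pdy (hU : IsOpen U) {F : Vec 2 → Vec 2 → ℝ} {f : smoothAlg (U ×ˢ slit 2)}
    (h : Represents F f) (i : Fin 2) : Represents (pdy F i) ((slitCalculus hU).dy i f) := by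
  intro v
  refine Eq.trans ?_ (dirDeriv_apply (isOpen_prod_slit hU) _
    (F := fun p : Vec 2 × Vec 2 => F p.1 p.2) h v).symm
  have hc := HasFDerivAt.comp (f := fun y => (v.1.1, y)) v.1.2
    (h.differentiableAt hU v).hasFDerivAt (hasFDerivAt_prodMk_right (𝕜 := ℝ) v.1.1 v.1.2)
  exact congrArg (· (Pi.single i 1)) hc.fderiv

lemma evalAt_y (hU : IsOpen U) (i : Fin 2) (v : (U ×ˢ slit 2 : Set (Vec 2 × Vec 2))) :
    evalAt v ((slitCalculus hU).y i) = v.1.2 i := rfl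

variable {G : Fin 2 → Vec 2 → Vec 2 → ℝ} {g : Fin 2 → smoothAlg (U ×ˢ slit 2)}

lemma represents_riem (hU : IsOpen U) (hg : ∀ i, Represents (G i) (g i)) (i k : Fin 2) :
    Represents (Riem G i k) ((slitCalculus hU).riem g i k) := by
  intro v
  have h1 (i k : Fin 2) := (hg i).pdy hU k
  simp only [Riem, Γc, Nc, Fin.sum_univ_two, SlitCalculus.riem, SlitCalculus.sprayField_apply,
    (hg _).pdx hU _ v, ((hg _).pdx hU _).pdy hU _ v, h1 _ _ v, (h1 _ _).pdy hU _ v, hg _ v,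
    map_add, map_sub, map_mul, map_ofNat, evalAt_y, SlitCalculus.dy_dx,
    SlitCalculus.dy_dy _ k]
  ring

lemma represents_ricci (hU : IsOpen U) (hg : ∀ i, Represents (G i) (g i)) :
    Represents (Ricci G) ((slitCalculus hU).ricci g) := by
  intro v
  simp only [Ricci, SlitCalculus.ricci, Fin.sum_univ_two, represents_riem hU hg _ _ v, map_add]
  norm_num

lemma represents_Tcurv (hU : IsOpen U) (hg : ∀ i, Represents (G i) (g i)) (i k : Fin 2) :
    Represents (Tcurv G i k) ((1 / 2 : ℝ) • (slitCalculus hU).twiceT g i k) := by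
  intro v
  have hR := represents_ricci hU hg
  simp only [Tcurv, SlitCalculus.twiceT, represents_riem hU hg _ _ v, hR v, hR.pdy hU _ v,
    map_smul, map_add, map_sub, map_mul, map_ofNat, evalAt_y, smul_eq_mul,
    apply_ite (evalAt v), map_one, map_zero]
  ring

lemma represents_chiC (hU : IsOpen U) (hg : ∀ i, Represents (G i) (g i)) (k : Fin 2) :
    Represents (chiC G k) ((-(1 / 6) : ℝ) •
      ((slitCalculus hU).dy 0 ((slitCalculus hU).twiceT g 0 k) +
        (slitCalculus hU).dy 1 ((slitCalculus hU).twiceT g 1 k))) := by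
  intro v
  simp only [chiC, Fin.sum_univ_two, (represents_Tcurv hU hg _ _).pdy hU _ v,
    Derivation.map_smul, map_smul, map_add, smul_eq_mul]
  ring

lemma evalAt_spray_covariant (hU : IsOpen U) (hg : ∀ i, Represents (G i) (g i))
    (hom : ∀ i, (slitCalculus hU).IsHom 2 (g i)) {F : Fin 2 → Vec 2 → Vec 2 → ℝ}
    {f : Fin 2 → smoothAlg (U ×ˢ slit 2)} (hF : ∀ i, Represents (F i) (f i)) (k : Fin 2)
    (v : (U ×ˢ slit 2 : Set (Vec 2 × Vec 2))) :
    ∑ m, covD1 G F k m v.1.1 v.1.2 * v.1.2 m =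
      evalAt v ((slitCalculus hU).sprayField g (f k) -
        ((slitCalculus hU).dy k (g 0) * f 0 + (slitCalculus hU).dy k (g 1) * f 1)) := by
  have h1 (i k : Fin 2) := (hg i).pdy hU k
  have e (i : Fin 2) := congrArg (evalAt v) (hom i)
  have ek (i : Fin 2) := congrArg (evalAt v) ((hom i).dy k)
  simp only [map_add, map_mul, evalAt_y, map_natCast] at e ek
  push_cast at e ek
  simp only [covD1, hD, Γc, Nc, Fin.sum_univ_two, SlitCalculus.sprayField_apply,
    (hF _).pdx hU _ v, (hF _).pdy hU _ v, h1 _ _ v, (h1 _ _).pdy hU _ v, hF _ v,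
    map_add, map_sub, map_mul, map_ofNat, evalAt_y]
  linear_combination -(evalAt v ((slitCalculus hU).dy 0 (f k))) * e 0
    - evalAt v ((slitCalculus hU).dy 1 (f k)) * e 1 - evalAt v (f 0) * ek 0 - evalAt v (f 1) * ek 1

lemma evalAt_twiceB (hU : IsOpen U) (hg : ∀ i, Represents (G i) (g i))
    (hom : ∀ i, (slitCalculus hU).IsHom 2 (g i)) {F : Vec 2 → Vec 2 → ℝ}
    {f : smoothAlg (U ×ˢ slit 2)} (hF : Represents F f) (k : Fin 2)
    (v : (U ×ˢ slit 2 : Set (Vec 2 × Vec 2))) :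
    hD G F k v.1.1 v.1.2
        - (1/2) * ∑ m, covD1 G (fun j => pdy F j) k m v.1.1 v.1.2 * v.1.2 m =
      1 / 2 * evalAt v ((slitCalculus hU).twiceB g f k) := by
  have hN (l : Fin 2) := (hg l).pdy hU k v
  rw [evalAt_spray_covariant hU hg hom (fun i => hF.pdy hU i) k v]
  simp only [hD, Nc, Fin.sum_univ_two, SlitCalculus.twiceB, hF.pdx hU _ v, hF.pdy hU _ v, hN,
    map_add, map_sub, map_mul, map_ofNat]
  ring

/-- Positive homogeneity implies Euler's identity. -/
lemma Represents.isHom (hU : IsOpen U) {F : Vec 2 → Vec 2 → ℝ} {f : smoothAlg (U ×ˢ slit 2)}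
    (h : Represents F f) {d : ℕ}
    (hd : ∀ x ∈ U, ∀ y ∈ slit 2, ∀ c : ℝ, 0 < c → F x (c • y) = c ^ d * F x y) :
    (slitCalculus hU).IsHom d f := by
  refine smoothAlg_ext fun v => ?_
  have hF := (h.differentiableAt hU v).hasFDerivAt
  have h1 : (v : Vec 2 × Vec 2) = (v.1.1, (1 : ℝ) • v.1.2) := by simp
  have hγ : HasDerivAt (fun c : ℝ => (v.1.1, c • v.1.2)) (0, v.1.2) 1 := by
    simpa using (hasDerivAt_const (1 : ℝ) v.1.1).prodMk ((hasDerivAt_id (1 : ℝ)).smul_const v.1.2)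
  have hL := HasFDerivAt.comp_hasDerivAt_of_eq (1 : ℝ) hF hγ h1
  have hR : HasDerivAt (fun c : ℝ => F v.1.1 (c • v.1.2)) (d * F v.1.1 v.1.2) 1 := by
    have hp := (hasDerivAt_pow d (1 : ℝ)).mul_const (F v.1.1 v.1.2)
    rw [one_pow, mul_one] at hp
    refine hp.congr_of_eventuallyEq ?_
    filter_upwards [lt_mem_nhds (zero_lt_one' ℝ)] with c hc
    exact hd _ v.2.1 _ v.2.2 c hc
  have hu := hL.unique hR
  have hy (i : Fin 2) : evalAt v ((slitCalculus hU).dy i f) =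
      fderiv ℝ (fun p : Vec 2 × Vec 2 => F p.1 p.2) v (0, Pi.single i 1) :=
    dirDeriv_apply (isOpen_prod_slit hU) _ (F := fun p : Vec 2 × Vec 2 => F p.1 p.2) h v
  have hv : ((0, v.1.2) : Vec 2 × Vec 2) =
      v.1.2 0 • ((0, Pi.single 0 1) : Vec 2 × Vec 2) + v.1.2 1 • (0, Pi.single 1 1) := by
    ext i <;> fin_cases i <;> simp
  rw [hv, map_add, map_smul, map_smul] at hu
  simp only [map_add, map_mul, evalAt_y, map_natCast, hy, ← h v]
  exact hu

/-- A smooth function of the base point has vanishing vertical derivatives. -/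
lemma represents_base (hU : IsOpen U) {F : Vec 2 → ℝ} {l : smoothAlg (U ×ˢ slit 2)}
    (h : Represents (fun x _ => F x) l) (i : Fin 2) : (slitCalculus hU).dy i l = 0 := by
  refine smoothAlg_ext fun v => ?_
  rw [← h.pdy hU i v]
  simp [pdy]

lemma represents_Ghat (hU : IsOpen U) (hg : ∀ i, Represents (G i) (g i)) {σ : Vec 2 → ℝ}
    {l : smoothAlg (U ×ˢ slit 2)} (hl : Represents (fun x _ => Real.log (σ x)) l) (i : Fin 2) :
    Represents (Ghat G σ i) (g i + (-(1 / 3) : ℝ) • ((slitCalculus hU).dy 0 (g 0) +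
      (slitCalculus hU).dy 1 (g 1) - ((slitCalculus hU).y 0 * (slitCalculus hU).dx 0 l +
        (slitCalculus hU).y 1 * (slitCalculus hU).dx 1 l)) * (slitCalculus hU).y i) := by
  intro v
  have hlx (i : Fin 2) := hl.pdx hU i v
  simp only [pdx] at hlx
  have hN (i : Fin 2) := (hg i).pdy hU i v
  simp only [Ghat, Scurv, Nc, Fin.sum_univ_two, hlx, hN, hg i v, map_add, map_sub, map_mul,
    map_smul, evalAt_y, smul_eq_mul]
  push_cast
  ring

/-- The Berwald–Weyl curvature of a spray on a surface in terms of the spray alone. -/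
theorem BWeyl_eq (hU : IsOpen U) (hG : IsSpray U G) {σ : Vec 2 → ℝ} (hσ : IsVolumeForm U σ)
    {x y : Vec 2} (hx : x ∈ U) (hy : y ∈ slit 2) (k : Fin 2) :
    BWeyl G σ k x y =
      hD G (Ricci G) k x y
        - (1/2) * ∑ m, covD1 G (fun j => pdy (Ricci G) j) k m x y * y m
        - (1/3) * ∑ m, covD1 G (chiC G) k m x y * y m := by
  let v : (U ×ˢ slit 2 : Set (Vec 2 × Vec 2)) := ⟨(x, y), hx, hy⟩
  let c := slitCalculus hU
  let g (i : Fin 2) := smoothRestrict _ (hG.1 i)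
  have hg (i : Fin 2) : Represents (G i) (g i) := fun _ => rfl
  have hom (i : Fin 2) : c.IsHom 2 (g i) := (hg i).isHom hU (hG.2 i)
  have hlog : ContDiffOn ℝ ∞ (fun p : Vec 2 × Vec 2 => Real.log (σ p.1)) (U ×ˢ slit 2) :=
    (hσ.1.comp contDiffOn_fst fun p hp => hp.1).log fun p hp => (hσ.2 p.1 hp.1).ne'
  let l := smoothRestrict _ hlog
  have hl : Represents (fun x _ => Real.log (σ x)) l := fun _ => rfl
  have hdl (i : Fin 2) : c.dy i l = 0 := represents_base hU hl i
  have hl0 : c.IsHom 0 l := by simp [SlitCalculus.IsHom, hdl]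
  let s := c.dy 0 (g 0) + c.dy 1 (g 1) - (c.y 0 * c.dx 0 l + c.y 1 * c.dx 1 l)
  let p := (-(1 / 3) : ℝ) • s
  have hs : c.IsHom 1 s := by
    have hN (i : Fin 2) : c.IsHom 1 (c.dy i (g i)) := (hom i).dy i
    have hy (i : Fin 2) : c.IsHom 1 (c.y i * c.dx i l) :=
      (SlitCalculus.isHom_y i).mul (hl0.dx i)
    exact ((hN 0).add (hN 1)).sub ((hy 0).add (hy 1))
  have hp : c.IsHom 1 p := by
    simp only [SlitCalculus.IsHom, p, Derivation.map_smul, mul_smul_comm, ← smul_add] at hs ⊢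
    rw [hs]
  have hsp : s = -3 * p := smoothAlg_ext fun w => by
    simp only [p, map_mul, map_neg, map_ofNat, map_smul, smul_eq_mul]
    ring
  let χ (k : Fin 2) := (-(1 / 6) : ℝ) • (c.dy 0 (c.twiceT g 0 k) + c.dy 1 (c.twiceT g 1 k))
  have hχ (k : Fin 2) : 6 * χ k = -(c.dy 0 (c.twiceT g 0 k) + c.dy 1 (c.twiceT g 1 k)) :=
    smoothAlg_ext fun w => by
      simp only [χ, map_mul, map_neg, map_ofNat, map_smul, smul_eq_mul]
      ring
  have hhat (i : Fin 2) : Represents (Ghat G σ i) (g i + p * c.y i) := represents_Ghat hU hg hl i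
  have h1 := evalAt_twiceB hU hhat (SlitCalculus.isHom_projective hom hp)
    (represents_ricci hU hhat) k v
  have h2 := evalAt_twiceB hU hg hom (represents_ricci hU hg) k v
  have h3 := evalAt_spray_covariant hU hg hom (represents_chiC hU hg) k v
  have h4 := congrArg (evalAt v) (SlitCalculus.twiceB_ricci_projective hom hp hdl hsp hχ k)
  simp only [map_mul, map_sub (evalAt v) (18 * _), map_ofNat] at h4
  refine h1.trans ?_
  change _ = (hD G (Ricci G) k v.1.1 v.1.2
    - (1/2) * ∑ m, covD1 G (fun j => pdy (Ricci G) j) k m v.1.1 v.1.2 * v.1.2 m)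
    - (1/3) * ∑ m, covD1 G (chiC G) k m v.1.1 v.1.2 * v.1.2 m
  rw [h2, h3]
  linear_combination (1 / 36) * h4

end Bridge

/-- Corollary 1.4: in dimension 2, for every volume form `dV` the Berwald–Weyl curvature is
`W^o_k = R_{|k} - ½ R_{·k|m} y^m - (1/3) χ_{k|m} y^m`; in particular it is independent of
the choice of `dV`. -/
theorem stmt_3 (U : Set (Vec 2)) (hU : IsOpen U) (hUne : U.Nonempty)
    (G : Fin 2 → Vec 2 → Vec 2 → ℝ) (hG : IsSpray U G) :
    (∀ σ : Vec 2 → ℝ, IsVolumeForm U σ → ∀ x ∈ U, ∀ y ∈ slit 2, ∀ k : Fin 2,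
      BWeyl G σ k x y =
        hD G (Ricci G) k x y
          - (1/2) * ∑ m, covD1 G (fun j => pdy (Ricci G) j) k m x y * y m
          - (1/3) * ∑ m, covD1 G (chiC G) k m x y * y m) ∧
    (∀ σ σ' : Vec 2 → ℝ, IsVolumeForm U σ → IsVolumeForm U σ' →
      ∀ x ∈ U, ∀ y ∈ slit 2, ∀ k : Fin 2, BWeyl G σ k x y = BWeyl G σ' k x y) := by
  have h (σ : Vec 2 → ℝ) (hσ : IsVolumeForm U σ) (x : Vec 2) (hx : x ∈ U) (y : Vec 2)
      (hy : y ∈ slit 2) (k : Fin 2) := BWeyl_eq hU hG hσ hx hy k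
  exact ⟨h, fun σ σ' hσ hσ' x hx y hy k => (h σ hσ x hx y hy k).trans (h σ' hσ' x hx y hy k).symm⟩

end BerwaldWeyl
end

section
/- Let F be a Finsler metric on a nonempty open set U ⊆ ℝ^n (n ≥ 2), G its induced spray, and dV = dV_BH its Busemann–Hausdorff volume form. If there are constants c and σ₀ such that the S-curvature of (G, dV_BH) satisfies S = (n+1)cF and the Ricci curvature satisfies R^m_m = (n−1)σ₀F², then the Berwald–Weyl curvature of (G, dV_BH) vanishes: W^o_k = 0 for all k. -/
open scoped BigOperators
open MeasureTheory

noncomputable section BerwaldWeyl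

/-- The square `F²` of a Finsler metric. -/
def Fsq {n : ℕ} (F : Vec n → Vec n → ℝ) : Vec n → Vec n → ℝ := fun x y => (F x y) ^ 2

/-- The fundamental tensor `g_{ij}(x,y) := ½ ∂²(F²)/∂y^i∂y^j` as a matrix. -/
def gmat {n : ℕ} (F : Vec n → Vec n → ℝ) (x y : Vec n) : Matrix (Fin n) (Fin n) ℝ :=
  fun i j => (1/2) * pdy (pdy (Fsq F) i) j x y

/-- A Finsler metric on `U`: smooth and positive on `U × (ℝⁿ \ {0})`, positively
1-homogeneous in `y`, with positive definite fundamental tensor. -/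
def IsFinsler {n : ℕ} (U : Set (Vec n)) (F : Vec n → Vec n → ℝ) : Prop :=
  ContDiffOn ℝ (⊤ : ℕ∞) (fun p : Vec n × Vec n => F p.1 p.2) (U ×ˢ slit n) ∧
  (∀ x ∈ U, ∀ y ∈ slit n, 0 < F x y) ∧
  (∀ x ∈ U, ∀ y ∈ slit n, ∀ c : ℝ, 0 < c → F x (c • y) = c * F x y) ∧
  (∀ x ∈ U, ∀ y ∈ slit n, (gmat F x y).PosDef)

/-- The spray induced by a Finsler metric:
`G^i := ¼ g^{il}([F²]_{x^k y^l} y^k − [F²]_{x^l})`. -/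
def sprayF {n : ℕ} (F : Vec n → Vec n → ℝ) : Fin n → Vec n → Vec n → ℝ :=
  fun i x y => (1/4) * ∑ l, (gmat F x y)⁻¹ i l *
    (∑ k, y k * pdy (pdx (Fsq F) k) l x y - pdx (Fsq F) l x y)

/-- The Busemann–Hausdorff volume density
`σ_BH(x) := vol(Bⁿ) / vol {y | F(x,y) < 1}`. -/
def sigmaBH {n : ℕ} (F : Vec n → Vec n → ℝ) (x : Vec n) : ℝ :=
  (volume {y : Vec n | ∑ i, (y i) ^ 2 < 1}).toReal /
    (volume {y : Vec n | F x y < 1}).toReal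

/-- `f` is smooth on `U × (ℝⁿ \ {0})`. -/
def SlitSmooth {n : ℕ} (U : Set (Vec n)) (f : Vec n → Vec n → ℝ) : Prop :=
  ContDiffOn ℝ (⊤ : ℕ∞) (fun p : Vec n × Vec n => f p.1 p.2) (U ×ˢ slit n)

/-- `f` satisfies Euler's identity of degree `d` in the vertical variable. -/
def SlitEuler {n : ℕ} (U : Set (Vec n)) (d : ℝ) (f : Vec n → Vec n → ℝ) : Prop :=
  ∀ x ∈ U, ∀ y ∈ slit n, ∑ k, y k * pdy f k x y = d * f x y

section Calculus

variable {n : ℕ} {U : Set (Vec n)} {f g : Vec n → Vec n → ℝ} {x y : Vec n}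

lemma isOpen_slit : IsOpen (slit n) := isOpen_ne

lemma pdx_congr (hU : IsOpen U) (h : ∀ x ∈ U, ∀ y ∈ slit n, f x y = g x y) (i : Fin n) :
    ∀ x ∈ U, ∀ y ∈ slit n, pdx f i x y = pdx g i x y := by
  intro x hx y hy
  have : (fun x' => f x' y) =ᶠ[nhds x] fun x' => g x' y := by
    filter_upwards [hU.mem_nhds hx] with x' hx' using h x' hx' y hy
  simp only [pdx, this.fderiv_eq]

lemma pdy_congr (h : ∀ x ∈ U, ∀ y ∈ slit n, f x y = g x y) (i : Fin n) :
    ∀ x ∈ U, ∀ y ∈ slit n, pdy f i x y = pdy g i x y := by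
  intro x hx y hy
  have : (fun y' => f x y') =ᶠ[nhds y] fun y' => g x y' := by
    filter_upwards [isOpen_slit.mem_nhds hy] with y' hy' using h x hx y' hy'
  simp only [pdy, this.fderiv_eq]

namespace SlitSmooth

lemma contDiffAt (hU : IsOpen U) (hf : SlitSmooth U f) (hx : x ∈ U) (hy : y ∈ slit n) :
    ContDiffAt ℝ (⊤ : ℕ∞) (fun p : Vec n × Vec n => f p.1 p.2) (x, y) :=
  ContDiffOn.contDiffAt hf ((hU.prod isOpen_slit).mem_nhds ⟨hx, hy⟩)

lemma differentiableAt (hU : IsOpen U) (hf : SlitSmooth U f) (hx : x ∈ U) (hy : y ∈ slit n) :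
    DifferentiableAt ℝ (fun p : Vec n × Vec n => f p.1 p.2) (x, y) :=
  (hf.contDiffAt hU hx hy).differentiableAt (by simp)

lemma differentiableAt_left (hU : IsOpen U) (hf : SlitSmooth U f) (hx : x ∈ U)
    (hy : y ∈ slit n) : DifferentiableAt ℝ (fun x' => f x' y) x :=
  (hf.differentiableAt hU hx hy).comp (f := fun x' => (x', y)) x (by fun_prop)

lemma differentiableAt_right (hU : IsOpen U) (hf : SlitSmooth U f) (hx : x ∈ U)
    (hy : y ∈ slit n) : DifferentiableAt ℝ (fun y' => f x y') y :=
  (hf.differentiableAt hU hx hy).comp (f := fun y' => (x, y')) y (by fun_prop)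

lemma pdx_eq (hU : IsOpen U) (hf : SlitSmooth U f) (hx : x ∈ U) (hy : y ∈ slit n) (i : Fin n) :
    pdx f i x y =
      fderiv ℝ (fun p : Vec n × Vec n => f p.1 p.2) (x, y) (Pi.single i 1, 0) := by
  have h := (hf.differentiableAt hU hx hy).hasFDerivAt.comp x
    ((hasFDerivAt_id (𝕜 := ℝ) x).prodMk (hasFDerivAt_const y x))
  have h' : fderiv ℝ (fun x' => f x' y) x = _ := h.fderiv
  rw [pdx, h']
  simp

lemma pdy_eq (hU : IsOpen U) (hf : SlitSmooth U f) (hx : x ∈ U) (hy : y ∈ slit n) (i : Fin n) :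
    pdy f i x y =
      fderiv ℝ (fun p : Vec n × Vec n => f p.1 p.2) (x, y) (0, Pi.single i 1) := by
  have h := (hf.differentiableAt hU hx hy).hasFDerivAt.comp y
    ((hasFDerivAt_const x y).prodMk (hasFDerivAt_id (𝕜 := ℝ) y))
  have h' : fderiv ℝ (fun y' => f x y') y = _ := h.fderiv
  rw [pdy, h']
  simp

lemma fderiv_apply (hU : IsOpen U) (hf : SlitSmooth U f) (v : Vec n × Vec n) :
    SlitSmooth U (fun x y => fderiv ℝ (fun p : Vec n × Vec n => f p.1 p.2) (x, y) v) := by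
  have h := ContDiffOn.fderiv_of_isOpen (m := (⊤ : ℕ∞)) hf (hU.prod isOpen_slit) (by simp)
  exact h.clm_apply contDiffOn_const

protected lemma pdx (hU : IsOpen U) (hf : SlitSmooth U f) (i : Fin n) : SlitSmooth U (pdx f i) :=
  ContDiffOn.congr (hf.fderiv_apply hU (Pi.single i 1, 0))
    fun _ hp => hf.pdx_eq hU hp.1 hp.2 i

protected lemma pdy (hU : IsOpen U) (hf : SlitSmooth U f) (i : Fin n) : SlitSmooth U (pdy f i) :=
  ContDiffOn.congr (hf.fderiv_apply hU (0, Pi.single i 1))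
    fun _ hp => hf.pdy_eq hU hp.1 hp.2 i

lemma fderiv_fderiv_apply (hU : IsOpen U) (hf : SlitSmooth U f) (hx : x ∈ U) (hy : y ∈ slit n)
    (v w : Vec n × Vec n) :
    fderiv ℝ (fun p : Vec n × Vec n => fderiv ℝ (fun p : Vec n × Vec n => f p.1 p.2) p v)
      (x, y) w =
    fderiv ℝ (fderiv ℝ (fun p : Vec n × Vec n => f p.1 p.2)) (x, y) w v := by
  have h : DifferentiableAt ℝ (fderiv ℝ (fun p : Vec n × Vec n => f p.1 p.2)) (x, y) :=
    ((hf.contDiffAt hU hx hy).fderiv_right (m := 1) (by norm_cast)).differentiableAt (by simp)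
  rw [fderiv_clm_apply h (differentiableAt_const v)]
  simp

lemma fderiv_comm (hU : IsOpen U) (hf : SlitSmooth U f) (hx : x ∈ U) (hy : y ∈ slit n)
    (v w : Vec n × Vec n) :
    fderiv ℝ (fun p : Vec n × Vec n => fderiv ℝ (fun p : Vec n × Vec n => f p.1 p.2) p v)
      (x, y) w =
    fderiv ℝ (fun p : Vec n × Vec n => fderiv ℝ (fun p : Vec n × Vec n => f p.1 p.2) p w)
      (x, y) v := by
  rw [hf.fderiv_fderiv_apply hU hx hy, hf.fderiv_fderiv_apply hU hx hy]
  exact ((hf.contDiffAt hU hx hy).isSymmSndFDerivAt (by simp; norm_cast)) w v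

lemma pdy_pdy_comm (hU : IsOpen U) (hf : SlitSmooth U f) (hx : x ∈ U) (hy : y ∈ slit n)
    (i j : Fin n) : pdy (pdy f i) j x y = pdy (pdy f j) i x y := by
  rw [pdy_congr (fun x hx y hy => hf.pdy_eq hU hx hy i) j x hx y hy,
    pdy_congr (fun x hx y hy => hf.pdy_eq hU hx hy j) i x hx y hy,
    (hf.fderiv_apply hU _).pdy_eq hU hx hy, (hf.fderiv_apply hU _).pdy_eq hU hx hy]
  exact hf.fderiv_comm hU hx hy _ _

lemma pdx_pdy_comm (hU : IsOpen U) (hf : SlitSmooth U f) (hx : x ∈ U) (hy : y ∈ slit n)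
    (i j : Fin n) : pdx (pdy f i) j x y = pdy (pdx f j) i x y := by
  rw [pdx_congr hU (fun x hx y hy => hf.pdy_eq hU hx hy i) j x hx y hy,
    pdy_congr (fun x hx y hy => hf.pdx_eq hU hx hy j) i x hx y hy,
    (hf.fderiv_apply hU _).pdx_eq hU hx hy, (hf.fderiv_apply hU _).pdy_eq hU hx hy]
  exact hf.fderiv_comm hU hx hy _ _

protected lemma add (hf : SlitSmooth U f) (hg : SlitSmooth U g) :
    SlitSmooth U (fun x y => f x y + g x y) := ContDiffOn.add hf hg

protected lemma sub (hf : SlitSmooth U f) (hg : SlitSmooth U g) :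
    SlitSmooth U (fun x y => f x y - g x y) := ContDiffOn.sub hf hg

protected lemma mul (hf : SlitSmooth U f) (hg : SlitSmooth U g) :
    SlitSmooth U (fun x y => f x y * g x y) := ContDiffOn.mul hf hg

protected lemma const_mul (a : ℝ) (hf : SlitSmooth U f) :
    SlitSmooth U (fun x y => a * f x y) := ContDiffOn.mul contDiffOn_const hf

protected lemma sum {ι : Type*} {s : Finset ι} {f : ι → Vec n → Vec n → ℝ}
    (hf : ∀ i ∈ s, SlitSmooth U (f i)) : SlitSmooth U (fun x y => ∑ i ∈ s, f i x y) :=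
  ContDiffOn.sum hf

protected lemma coord (k : Fin n) : SlitSmooth U (fun _ y => y k) :=
  ContDiff.contDiffOn (by fun_prop)

protected lemma det {ι : Type*} [Fintype ι] [DecidableEq ι] {A : Vec n → Vec n → Matrix ι ι ℝ}
    (hA : ∀ i j, SlitSmooth U (fun x y => A x y i j)) : SlitSmooth U (fun x y => (A x y).det) := by
  simp only [Matrix.det_apply]
  refine SlitSmooth.sum fun s _ => ?_
  exact ContDiffOn.const_smul _ (contDiffOn_prod fun i _ => hA _ _)

protected lemma inv_apply {ι : Type*} [Fintype ι] [DecidableEq ι]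
    {A : Vec n → Vec n → Matrix ι ι ℝ}
    (hA : ∀ i j, SlitSmooth U (fun x y => A x y i j))
    (hdet : ∀ x ∈ U, ∀ y ∈ slit n, (A x y).det ≠ 0) (i j : ι) :
    SlitSmooth U (fun x y => (A x y)⁻¹ i j) := by
  have hadj : SlitSmooth U (fun x y => (A x y).adjugate i j) := by
    simp only [Matrix.adjugate_apply]
    refine SlitSmooth.det fun k l => ?_
    by_cases hk : k = j
    · subst hk
      simp only [Matrix.updateRow_self]
      exact contDiffOn_const
    · simpa only [Matrix.updateRow_ne hk] using hA k l
  have h := ContDiffOn.mul (ContDiffOn.inv (SlitSmooth.det hA) fun p hp => hdet _ hp.1 _ hp.2) hadj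
  simpa [SlitSmooth, Matrix.inv_def, Ring.inverse_eq_inv'] using h

end SlitSmooth

lemma pdy_add (hU : IsOpen U) (hf : SlitSmooth U f) (hg : SlitSmooth U g) (k : Fin n)
    (hx : x ∈ U) (hy : y ∈ slit n) :
    pdy (fun x y => f x y + g x y) k x y = pdy f k x y + pdy g k x y := by
  simp only [pdy]
  rw [fderiv_fun_add (hf.differentiableAt_right hU hx hy) (hg.differentiableAt_right hU hx hy)]
  rfl

lemma pdy_sub (hU : IsOpen U) (hf : SlitSmooth U f) (hg : SlitSmooth U g) (k : Fin n)
    (hx : x ∈ U) (hy : y ∈ slit n) :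
    pdy (fun x y => f x y - g x y) k x y = pdy f k x y - pdy g k x y := by
  simp only [pdy]
  rw [fderiv_fun_sub (hf.differentiableAt_right hU hx hy) (hg.differentiableAt_right hU hx hy)]
  rfl

lemma pdy_mul (hU : IsOpen U) (hf : SlitSmooth U f) (hg : SlitSmooth U g) (k : Fin n)
    (hx : x ∈ U) (hy : y ∈ slit n) :
    pdy (fun x y => f x y * g x y) k x y = pdy f k x y * g x y + f x y * pdy g k x y := by
  simp only [pdy]
  rw [fderiv_fun_mul (hf.differentiableAt_right hU hx hy) (hg.differentiableAt_right hU hx hy)]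
  simp
  ring

lemma pdy_const_mul (hU : IsOpen U) (a : ℝ) (hf : SlitSmooth U f) (k : Fin n)
    (hx : x ∈ U) (hy : y ∈ slit n) :
    pdy (fun x y => a * f x y) k x y = a * pdy f k x y := by
  simp only [pdy]
  rw [fderiv_const_mul (hf.differentiableAt_right hU hx hy)]
  rfl

lemma pdy_sum (hU : IsOpen U) {ι : Type*} {s : Finset ι} {f : ι → Vec n → Vec n → ℝ}
    (hf : ∀ i ∈ s, SlitSmooth U (f i)) (k : Fin n) (hx : x ∈ U) (hy : y ∈ slit n) :
    pdy (fun x y => ∑ i ∈ s, f i x y) k x y = ∑ i ∈ s, pdy (f i) k x y := by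
  simp only [pdy]
  rw [fderiv_fun_sum fun i hi => (hf i hi).differentiableAt_right hU hx hy]
  simp

lemma pdy_coord (m k : Fin n) (x y : Vec n) :
    pdy (fun _ y => y m) k x y = if m = k then 1 else 0 := by
  have h : HasFDerivAt (fun y' : Vec n => y' m) (ContinuousLinearMap.proj (R := ℝ) m) y :=
    hasFDerivAt_apply m y
  simp [pdy, h.fderiv, Pi.single_apply]

lemma pdx_add (hU : IsOpen U) (hf : SlitSmooth U f) (hg : SlitSmooth U g) (k : Fin n)
    (hx : x ∈ U) (hy : y ∈ slit n) :
    pdx (fun x y => f x y + g x y) k x y = pdx f k x y + pdx g k x y := by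
  simp only [pdx]
  rw [fderiv_fun_add (hf.differentiableAt_left hU hx hy) (hg.differentiableAt_left hU hx hy)]
  rfl

lemma pdx_mul (hU : IsOpen U) (hf : SlitSmooth U f) (hg : SlitSmooth U g) (k : Fin n)
    (hx : x ∈ U) (hy : y ∈ slit n) :
    pdx (fun x y => f x y * g x y) k x y = pdx f k x y * g x y + f x y * pdx g k x y := by
  simp only [pdx]
  rw [fderiv_fun_mul (hf.differentiableAt_left hU hx hy) (hg.differentiableAt_left hU hx hy)]
  simp
  ring

lemma pdx_const_mul (hU : IsOpen U) (a : ℝ) (hf : SlitSmooth U f) (k : Fin n)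
    (hx : x ∈ U) (hy : y ∈ slit n) :
    pdx (fun x y => a * f x y) k x y = a * pdx f k x y := by
  simp only [pdx]
  rw [fderiv_const_mul (hf.differentiableAt_left hU hx hy)]
  rfl

lemma pdx_coord (m k : Fin n) (x y : Vec n) : pdx (fun _ y => y m) k x y = 0 := by
  simp [pdx]

lemma pdx_sum (hU : IsOpen U) {ι : Type*} {s : Finset ι} {f : ι → Vec n → Vec n → ℝ}
    (hf : ∀ i ∈ s, SlitSmooth U (f i)) (k : Fin n) (hx : x ∈ U) (hy : y ∈ slit n) :
    pdx (fun x y => ∑ i ∈ s, f i x y) k x y = ∑ i ∈ s, pdx (f i) k x y := by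
  simp only [pdx]
  rw [fderiv_fun_sum fun i hi => (hf i hi).differentiableAt_left hU hx hy]
  simp

/-- Differentiating a contraction `y^i f_i` vertically. -/
lemma pdy_sum_coord_mul (hU : IsOpen U) {f : Fin n → Vec n → Vec n → ℝ}
    (hf : ∀ i, SlitSmooth U (f i)) (k : Fin n) (hx : x ∈ U) (hy : y ∈ slit n) :
    pdy (fun x y => ∑ i, y i * f i x y) k x y = f k x y + ∑ i, y i * pdy (f i) k x y := by
  rw [pdy_sum hU (fun i _ => (SlitSmooth.coord i).mul (hf i)) k hx hy]
  simp only [pdy_mul hU (SlitSmooth.coord _) (hf _) k hx hy, pdy_coord, Finset.sum_add_distrib]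
  simp

/-- Differentiating a contraction `y^i f_i` in the base variable. -/
lemma pdx_sum_coord_mul (hU : IsOpen U) {f : Fin n → Vec n → Vec n → ℝ}
    (hf : ∀ i, SlitSmooth U (f i)) (k : Fin n) (hx : x ∈ U) (hy : y ∈ slit n) :
    pdx (fun x y => ∑ i, y i * f i x y) k x y = ∑ i, y i * pdx (f i) k x y := by
  rw [pdx_sum hU (fun i _ => (SlitSmooth.coord i).mul (hf i)) k hx hy]
  simp only [pdx_mul hU (SlitSmooth.coord _) (hf _) k hx hy, pdx_coord]
  simp

namespace SlitEuler

variable {d e : ℝ}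

lemma of_homogeneous (hU : IsOpen U) (hf : SlitSmooth U f)
    (h : ∀ x ∈ U, ∀ y ∈ slit n, ∀ c : ℝ, 0 < c → f x (c • y) = c * f x y) :
    SlitEuler U 1 f := by
  intro x hx y hy
  have hd := hf.differentiableAt_right hU hx hy
  have hlin : ∑ k, y k * pdy f k x y = fderiv ℝ (fun y' => f x y') y y := by
    have hy_sum : y = ∑ k, y k • Pi.single k (1 : ℝ) := by
      ext i
      simp [Pi.single_apply]
    conv_rhs => rw [hy_sum, map_sum]
    simp [pdy, ← hy_sum]
  rw [hlin]
  have hray : HasDerivAt (fun t : ℝ => t • y) y 1 := by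
    simpa using (hasDerivAt_id (1 : ℝ)).smul_const y
  have h1 : HasDerivAt (fun t : ℝ => f x (t • y)) (fderiv ℝ (fun y' => f x y') y y) 1 := by
    have hd' : HasFDerivAt (fun y' => f x y') (fderiv ℝ (fun y' => f x y') y) ((1 : ℝ) • y) := by
      simpa using hd.hasFDerivAt
    exact hd'.comp_hasDerivAt 1 hray
  have h2 : HasDerivAt (fun t : ℝ => t * f x y) (1 * f x y) 1 :=
    (hasDerivAt_id (1 : ℝ)).mul_const _
  have heq : (fun t : ℝ => f x (t • y)) =ᶠ[nhds 1] fun t => t * f x y := by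
    filter_upwards [lt_mem_nhds (zero_lt_one' ℝ)] with t ht using h x hx y hy t ht
  exact (h1.congr_of_eventuallyEq heq.symm).unique h2

protected lemma mul (hU : IsOpen U) (hfs : SlitSmooth U f) (hgs : SlitSmooth U g)
    (hf : SlitEuler U d f) (hg : SlitEuler U e g) :
    SlitEuler U (d + e) (fun x y => f x y * g x y) := by
  intro x hx y hy
  simp only [pdy_mul hU hfs hgs _ hx hy]
  have h1 := hf x hx y hy
  have h2 := hg x hx y hy
  calc ∑ k, y k * (pdy f k x y * g x y + f x y * pdy g k x y)
      = (∑ k, y k * pdy f k x y) * g x y + f x y * ∑ k, y k * pdy g k x y := by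
        rw [Finset.sum_mul, Finset.mul_sum, ← Finset.sum_add_distrib]
        exact Finset.sum_congr rfl fun k _ => by ring
    _ = _ := by rw [h1, h2]; ring

protected lemma const_mul (hU : IsOpen U) (a : ℝ) (hfs : SlitSmooth U f) (hf : SlitEuler U d f) :
    SlitEuler U d (fun x y => a * f x y) := by
  intro x hx y hy
  simp only [pdy_const_mul hU a hfs _ hx hy, mul_left_comm _ a, ← Finset.mul_sum, hf x hx y hy]

protected lemma add (hU : IsOpen U) (hfs : SlitSmooth U f) (hgs : SlitSmooth U g)
    (hf : SlitEuler U d f) (hg : SlitEuler U d g) :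
    SlitEuler U d (fun x y => f x y + g x y) := by
  intro x hx y hy
  simp only [pdy_add hU hfs hgs _ hx hy, mul_add, Finset.sum_add_distrib, hf x hx y hy,
    hg x hx y hy]

protected lemma sub (hU : IsOpen U) (hfs : SlitSmooth U f) (hgs : SlitSmooth U g)
    (hf : SlitEuler U d f) (hg : SlitEuler U d g) :
    SlitEuler U d (fun x y => f x y - g x y) := by
  intro x hx y hy
  simp only [pdy_sub hU hfs hgs _ hx hy, mul_sub, Finset.sum_sub_distrib, hf x hx y hy,
    hg x hx y hy]

protected lemma sum (hU : IsOpen U) {ι : Type*} {s : Finset ι} {f : ι → Vec n → Vec n → ℝ}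
    (hfs : ∀ i ∈ s, SlitSmooth U (f i)) (hf : ∀ i ∈ s, SlitEuler U d (f i)) :
    SlitEuler U d (fun x y => ∑ i ∈ s, f i x y) := by
  intro x hx y hy
  simp only [pdy_sum hU hfs _ hx hy, Finset.mul_sum]
  rw [Finset.sum_comm]
  exact Finset.sum_congr rfl fun i hi => hf i hi x hx y hy

protected lemma coord (k : Fin n) : SlitEuler U 1 (fun _ y => y k) := by
  intro x _ y _
  simp [pdy_coord]

protected lemma pdy (hU : IsOpen U) (hfs : SlitSmooth U f) (hf : SlitEuler U d f) (j : Fin n) :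
    SlitEuler U (d - 1) (pdy f j) := by
  intro x hx y hy
  have h := pdy_congr hf j x hx y hy
  rw [pdy_sum_coord_mul hU (hfs.pdy hU) j hx hy, pdy_const_mul hU d hfs j hx hy] at h
  simp only [hfs.pdy_pdy_comm hU hx hy j]
  linarith

protected lemma pdx (hU : IsOpen U) (hfs : SlitSmooth U f) (hf : SlitEuler U d f) (j : Fin n) :
    SlitEuler U d (pdx f j) := by
  intro x hx y hy
  have h := pdx_congr hU hf j x hx y hy
  rw [pdx_sum_coord_mul hU (hfs.pdy hU) j hx hy, pdx_const_mul hU d hfs j hx hy] at h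
  simpa only [hfs.pdx_pdy_comm hU hx hy] using h

end SlitEuler

end Calculus

section ProjectiveChange

variable {n : ℕ} {U : Set (Vec n)} {G G' : Fin n → Vec n → Vec n → ℝ} {P h : Vec n → Vec n → ℝ}
  {x y : Vec n}

lemma Riem_congr (hU : IsOpen U) (hG : ∀ i, ∀ x ∈ U, ∀ y ∈ slit n, G i x y = G' i x y)
    (i k : Fin n) : ∀ x ∈ U, ∀ y ∈ slit n, Riem G i k x y = Riem G' i k x y := by
  intro x hx y hy
  simp only [Riem, Nc, Γc, pdx_congr hU (hG _) _ x hx y hy, pdy_congr (hG _) _ x hx y hy,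
    pdy_congr (pdx_congr hU (hG _) _) _ x hx y hy, pdy_congr (pdy_congr (hG _) _) _ x hx y hy,
    hG _ x hx y hy]

lemma BWeyl_eq_of_eqOn (hU : IsOpen U) {σ : Vec n → ℝ}
    (hG : ∀ i, ∀ x ∈ U, ∀ y ∈ slit n, Ghat G σ i x y = G' i x y)
    (hR : ∀ x ∈ U, ∀ y ∈ slit n, Ricci (Ghat G σ) x y = h x y) (hx : x ∈ U) (hy : y ∈ slit n)
    (k : Fin n) :
    BWeyl G σ k x y = hD G' h k x y - (1/2) * ∑ m, covD1 G' (fun j => pdy h j) k m x y * y m := by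
  simp only [BWeyl, hD, covD1, Nc, Γc, pdx_congr hU hR _ x hx y hy, pdy_congr hR _ x hx y hy,
    pdx_congr hU (pdy_congr hR _) _ x hx y hy, pdy_congr (pdy_congr hR _) _ x hx y hy,
    pdy_congr (hG _) _ x hx y hy, pdy_congr (pdy_congr (hG _) _) _ x hx y hy]

/-- The projectively changed spray `G^i + P y^i`. -/
def projChange (G : Fin n → Vec n → Vec n → ℝ) (P : Vec n → Vec n → ℝ) :
    Fin n → Vec n → Vec n → ℝ :=
  fun i x y => G i x y + P x y * y i

lemma SlitSmooth.projChange (hG : ∀ i, SlitSmooth U (G i)) (hP : SlitSmooth U P) (i : Fin n) :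
    SlitSmooth U (projChange G P i) :=
  (hG i).add (hP.mul (SlitSmooth.coord i))

lemma pdx_projChange (hU : IsOpen U) (hG : ∀ i, SlitSmooth U (G i)) (hP : SlitSmooth U P)
    (i j : Fin n) : ∀ x ∈ U, ∀ y ∈ slit n,
    pdx (projChange G P i) j x y = pdx (G i) j x y + pdx P j x y * y i := by
  intro x hx y hy
  unfold projChange
  rw [pdx_add hU (hG i) (hP.mul (SlitSmooth.coord i)) j hx hy,
    pdx_mul hU hP (SlitSmooth.coord i) j hx hy, pdx_coord]
  ring

lemma pdy_pdx_projChange (hU : IsOpen U) (hG : ∀ i, SlitSmooth U (G i)) (hP : SlitSmooth U P)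
    (i j k : Fin n) (hx : x ∈ U) (hy : y ∈ slit n) :
    pdy (pdx (projChange G P i) j) k x y = pdy (pdx (G i) j) k x y
      + (pdy (pdx P j) k x y * y i + pdx P j x y * if i = k then 1 else 0) := by
  rw [pdy_congr (pdx_projChange hU hG hP i j) k x hx y hy,
    pdy_add hU ((hG i).pdx hU j) ((hP.pdx hU j).mul (SlitSmooth.coord i)) k hx hy,
    pdy_mul hU (hP.pdx hU j) (SlitSmooth.coord i) k hx hy, pdy_coord]

lemma Nc_projChange (hU : IsOpen U) (hG : ∀ i, SlitSmooth U (G i)) (hP : SlitSmooth U P)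
    (i j : Fin n) : ∀ x ∈ U, ∀ y ∈ slit n,
    Nc (projChange G P) i j x y =
      Nc G i j x y + (pdy P j x y * y i + P x y * if i = j then 1 else 0) := by
  intro x hx y hy
  unfold projChange Nc
  rw [pdy_add hU (hG i) (hP.mul (SlitSmooth.coord i)) j hx hy,
    pdy_mul hU hP (SlitSmooth.coord i) j hx hy, pdy_coord]

lemma Γc_projChange (hU : IsOpen U) (hG : ∀ i, SlitSmooth U (G i)) (hP : SlitSmooth U P)
    (i j k : Fin n) (hx : x ∈ U) (hy : y ∈ slit n) :
    Γc (projChange G P) i j k x y = Γc G i j k x y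
      + (pdy (pdy P j) k x y * y i + (pdy P j x y * if i = k then 1 else 0)
        + pdy P k x y * if i = j then 1 else 0) := by
  have hPj := hP.pdy hU j
  have hδ : SlitSmooth U (fun _ _ : Vec n => if i = j then (1 : ℝ) else 0) := contDiffOn_const
  have hδ' : pdy (fun _ _ : Vec n => if i = j then (1 : ℝ) else 0) k x y = 0 := by simp [pdy]
  have hc := pdy_congr (Nc_projChange hU hG hP i j) k x hx y hy
  unfold Nc at hc
  rw [pdy_add hU ((hG i).pdy hU j) ((hPj.mul (SlitSmooth.coord i)).add (hP.mul hδ)) k hx hy,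
    pdy_add hU (hPj.mul (SlitSmooth.coord i)) (hP.mul hδ) k hx hy,
    pdy_mul hU hPj (SlitSmooth.coord i) k hx hy, pdy_mul hU hP hδ k hx hy, pdy_coord, hδ'] at hc
  unfold Γc
  rw [hc]
  ring

/-- The change of the Ricci curvature under `G ↦ G + P y`. -/
lemma sum_Riem_projChange (hU : IsOpen U) (hG : ∀ i, SlitSmooth U (G i))
    (hGe : ∀ i, SlitEuler U 2 (G i)) (hP : SlitSmooth U P) (hPe : SlitEuler U 1 P)
    (hx : x ∈ U) (hy : y ∈ slit n) :
    ∑ m, Riem (projChange G P) m m x y = ∑ m, Riem G m m x y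
      + ((n : ℝ) - 1) * (P x y ^ 2
        - (∑ j, y j * pdx P j x y - 2 * ∑ j, G j x y * pdy P j x y)) := by
  have eN : ∀ i, ∑ j, y j * Nc G i j x y = 2 * G i x y := fun i => hGe i x hx y hy
  have eP : ∑ j, y j * pdy P j x y = P x y := by simpa using hPe x hx y hy
  have eΓ : ∀ m, ∑ j, y j * Γc G m j m x y = Nc G m m x y := by
    intro m
    have := (hGe m).pdy hU (hG m) m x hx y hy
    simp only [(hG m).pdy_pdy_comm hU hx hy m] at this
    norm_num at this
    exact this
  have ePP : ∀ j, ∑ m, pdy (pdy P j) m x y * y m = 0 := by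
    intro j
    have := hPe.pdy hU hP j x hx y hy
    simpa [mul_comm] using this
  have exP : ∀ j, ∑ m, pdy (pdx P j) m x y * y m = pdx P j x y := by
    intro j
    have := hPe.pdx hU hP j x hx y hy
    simpa [mul_comm] using this
  have t1 : ∑ m, pdx (projChange G P m) m x y
      = ∑ m, pdx (G m) m x y + ∑ j, y j * pdx P j x y := by
    simp only [pdx_projChange hU hG hP _ _ x hx y hy, Finset.sum_add_distrib, mul_comm]
  have t2 : ∑ m, ∑ j, y j * pdy (pdx (projChange G P m) j) m x y
      = ∑ m, ∑ j, y j * pdy (pdx (G m) j) m x y + ((n : ℝ) + 1) * ∑ j, y j * pdx P j x y := by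
    simp only [pdy_pdx_projChange hU hG hP _ _ _ hx hy, mul_add, Finset.sum_add_distrib]
    congr 1
    rw [Finset.sum_comm]
    simp only [← Finset.mul_sum, exP]
    simp
    ring
  have t3 : ∑ m, ∑ j, projChange G P j x y * Γc (projChange G P) m j m x y
      = ∑ m, ∑ j, G j x y * Γc G m j m x y + P x y * ∑ m, Nc G m m x y
        + ((n : ℝ) + 1) * ∑ j, G j x y * pdy P j x y + ((n : ℝ) + 1) * P x y ^ 2 := by
    have hΓ : ∀ j, ∑ m, Γc (projChange G P) m j m x y
        = ∑ m, Γc G m j m x y + ((n : ℝ) + 1) * pdy P j x y := by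
      intro j
      simp only [Γc_projChange hU hG hP _ _ _ hx hy, Finset.sum_add_distrib, ePP]
      simp
      ring
    rw [Finset.sum_comm]
    simp only [← Finset.mul_sum, hΓ]
    have e1 : ∑ j, y j * ∑ m, Γc G m j m x y = ∑ m, Nc G m m x y := by
      simp only [Finset.mul_sum]
      rw [Finset.sum_comm]
      simp only [eΓ]
    have e2 : ∑ m, ∑ j, G j x y * Γc G m j m x y = ∑ j, G j x y * ∑ m, Γc G m j m x y := by
      rw [Finset.sum_comm]
      simp only [Finset.mul_sum]
    rw [e2, ← e1]
    calc _ = ∑ j, (G j x y * ∑ m, Γc G m j m x y + P x y * (y j * ∑ m, Γc G m j m x y)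
            + ((n : ℝ) + 1) * (G j x y * pdy P j x y)
            + ((n : ℝ) + 1) * P x y * (y j * pdy P j x y)) :=
          Finset.sum_congr rfl fun j _ => by unfold projChange; ring
      _ = _ := by
          simp only [Finset.sum_add_distrib, ← Finset.mul_sum, eP]
          ring
  have t4 : ∑ m, ∑ s, Nc (projChange G P) m s x y * Nc (projChange G P) s m x y
      = ∑ m, ∑ s, Nc G m s x y * Nc G s m x y + 4 * ∑ j, G j x y * pdy P j x y
        + 2 * P x y * ∑ m, Nc G m m x y + ((n : ℝ) + 3) * P x y ^ 2 := by
    simp only [Nc_projChange hU hG hP _ _ x hx y hy]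
    have e1 : ∑ m, ∑ s, Nc G m s x y * (pdy P m x y * y s) = 2 * ∑ j, G j x y * pdy P j x y := by
      rw [Finset.mul_sum]
      refine Finset.sum_congr rfl fun m _ => ?_
      rw [← mul_assoc, ← eN m, Finset.sum_mul]
      exact Finset.sum_congr rfl fun s _ => by ring
    have e2 : ∑ m, ∑ s, pdy P s x y * y m * Nc G s m x y = 2 * ∑ j, G j x y * pdy P j x y := by
      rw [← e1, Finset.sum_comm]
      exact Finset.sum_congr rfl fun m _ => Finset.sum_congr rfl fun s _ => by ring
    have e3 : ∑ m, ∑ s, pdy P s x y * y m * (pdy P m x y * y s) = P x y ^ 2 := by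
      rw [sq, ← eP, Finset.sum_mul_sum]
      exact Finset.sum_congr rfl fun m _ => Finset.sum_congr rfl fun s _ => by ring
    have e4 : ∑ m, pdy P m x y * y m = P x y := by simpa only [mul_comm] using eP
    have e5 : ∑ m, P x y * (pdy P m x y * y m) = P x y ^ 2 := by rw [← Finset.mul_sum, e4, sq]
    have e6 : ∑ m, pdy P m x y * (y m * P x y) = P x y ^ 2 := by
      simp only [← mul_assoc, ← Finset.sum_mul, e4, sq]
    simp only [add_mul, mul_add, Finset.sum_add_distrib, e1, e2, e3]
    simp [← Finset.sum_mul, ← Finset.mul_sum, mul_assoc, e5, e6]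
    ring
  simp only [Riem, Finset.sum_add_distrib, Finset.sum_sub_distrib, ← Finset.mul_sum, t1, t2, t3,
    t4]
  ring

/-- If `h` is `2`-homogeneous and horizontally constant for `G`, this is the value of
`h_{∥k} - ½ h_{·k∥m} y^m` for the projectively changed spray `G + P y`. -/
lemma hD_sub_covD1_projChange (hU : IsOpen U) (hG : ∀ i, SlitSmooth U (G i))
    (hGe : ∀ i, SlitEuler U 2 (G i)) (hP : SlitSmooth U P) (hPe : SlitEuler U 1 P)
    (hh : SlitSmooth U h) (hhe : SlitEuler U 2 h)
    (hpar : ∀ k, ∀ x ∈ U, ∀ y ∈ slit n, pdx h k x y = ∑ l, Nc G l k x y * pdy h l x y)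
    (hx : x ∈ U) (hy : y ∈ slit n) (k : Fin n) :
    hD (projChange G P) h k x y
        - (1/2) * ∑ m, covD1 (projChange G P) (fun j => pdy h j) k m x y * y m
      = 1/2 * P x y * pdy h k x y - h x y * pdy P k x y := by
  have eh : ∑ l, pdy h l x y * y l = 2 * h x y := by
    simpa only [mul_comm] using hhe x hx y hy
  have ehh : ∑ l, y l * pdy (pdy h l) k x y = pdy h k x y := by
    have := hhe.pdy hU hh k x hx y hy
    simp only [hh.pdy_pdy_comm hU hx hy k] at this
    norm_num at this
    exact this
  have eNh : ∑ l, Nc (projChange G P) l k x y * pdy h l x y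
      = ∑ l, Nc G l k x y * pdy h l x y + 2 * h x y * pdy P k x y + P x y * pdy h k x y := by
    simp only [Nc_projChange hU hG hP _ _ x hx y hy, add_mul, Finset.sum_add_distrib]
    have : ∑ l, pdy P k x y * y l * pdy h l x y = 2 * h x y * pdy P k x y := by
      rw [← eh, Finset.sum_mul]
      exact Finset.sum_congr rfl fun l _ => by ring
    rw [this]
    simp
    ring
  have hGh : ∀ i, SlitEuler U 2 (projChange G P i) := by
    intro i
    have := hPe.mul hU hP (SlitSmooth.coord i) (SlitEuler.coord i)
    norm_num at this
    exact (hGe i).add hU (hG i) (hP.mul (SlitSmooth.coord i)) this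
  have eN : ∀ l, ∑ m, y m * Nc (projChange G P) l m x y = 2 * projChange G P l x y :=
    fun l => hGh l x hx y hy
  have eΓ : ∀ l, ∑ m, y m * Γc (projChange G P) l k m x y = Nc (projChange G P) l k x y := by
    intro l
    have := (hGh l).pdy hU (SlitSmooth.projChange hG hP l) k x hx y hy
    norm_num at this
    exact this
  have hspray : ∀ x ∈ U, ∀ y ∈ slit n,
      ∑ m, y m * pdx h m x y = 2 * ∑ l, G l x y * pdy h l x y := by
    intro x hx y hy
    simp only [hpar _ x hx y hy, Finset.mul_sum]
    rw [Finset.sum_comm]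
    refine Finset.sum_congr rfl fun l _ => ?_
    have : ∑ m, y m * Nc G l m x y = 2 * G l x y := hGe l x hx y hy
    rw [← mul_assoc, ← this, Finset.sum_mul]
    exact Finset.sum_congr rfl fun m _ => by ring
  have hD0 := pdy_congr hspray k x hx y hy
  rw [pdy_sum_coord_mul hU (fun i => hh.pdx hU i) k hx hy,
    pdy_const_mul hU 2 (SlitSmooth.sum fun l _ => (hG l).mul (hh.pdy hU l)) k hx hy,
    pdy_sum hU (fun l _ => (hG l).mul (hh.pdy hU l)) k hx hy, hpar k x hx y hy] at hD0
  simp only [pdy_mul hU (hG _) (hh.pdy hU _) k hx hy, Finset.sum_add_distrib] at hD0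
  have hcov : ∑ m, covD1 (projChange G P) (fun j => pdy h j) k m x y * y m
      = ∑ m, y m * pdy (pdx h m) k x y - 2 * ∑ l, projChange G P l x y * pdy (pdy h l) k x y
        - ∑ l, Nc (projChange G P) l k x y * pdy h l x y := by
    simp only [covD1, hD, sub_mul, Finset.sum_sub_distrib, Finset.sum_mul,
      hh.pdx_pdy_comm hU hx hy]
    congr 1
    · congr 1
      · exact Finset.sum_congr rfl fun m _ => by ring
      · rw [Finset.sum_comm, Finset.mul_sum]
        refine Finset.sum_congr rfl fun l _ => ?_
        rw [← mul_assoc, ← eN l, Finset.sum_mul]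
        refine Finset.sum_congr rfl fun m _ => ?_
        rw [hh.pdy_pdy_comm hU hx hy k l]
        ring
    · rw [Finset.sum_comm]
      refine Finset.sum_congr rfl fun l _ => ?_
      rw [← eΓ l, Finset.sum_mul]
      exact Finset.sum_congr rfl fun m _ => by ring
  have hproj : ∑ l, projChange G P l x y * pdy (pdy h l) k x y
      = ∑ l, G l x y * pdy (pdy h l) k x y + P x y * pdy h k x y := by
    rw [← ehh, Finset.mul_sum, ← Finset.sum_add_distrib]
    exact Finset.sum_congr rfl fun l _ => by unfold projChange; ring
  have hNc : ∑ l, pdy (G l) k x y * pdy h l x y = ∑ l, Nc G l k x y * pdy h l x y := rfl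
  rw [hcov, hproj]
  simp only [hD]
  rw [eNh, hpar k x hx y hy]
  rw [hNc] at hD0
  linarith

end ProjectiveChange

section Finsler

variable {n : ℕ} {U : Set (Vec n)} {F : Vec n → Vec n → ℝ} {x y : Vec n}

namespace IsFinsler

lemma slitSmooth (hF : IsFinsler U F) : SlitSmooth U F := hF.1

lemma slitEuler (hU : IsOpen U) (hF : IsFinsler U F) : SlitEuler U 1 F :=
  SlitEuler.of_homogeneous hU hF.slitSmooth hF.2.2.1

lemma slitSmooth_Fsq (hF : IsFinsler U F) : SlitSmooth U (Fsq F) := by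
  have h := hF.slitSmooth.mul hF.slitSmooth
  simp only [← sq] at h
  exact h

lemma slitEuler_Fsq (hU : IsOpen U) (hF : IsFinsler U F) : SlitEuler U 2 (Fsq F) := by
  have h := (hF.slitEuler hU).mul hU hF.slitSmooth hF.slitSmooth (hF.slitEuler hU)
  norm_num [← sq] at h
  exact h

lemma pdx_Fsq (hU : IsOpen U) (hF : IsFinsler U F) (hx : x ∈ U) (hy : y ∈ slit n) (k : Fin n) :
    pdx (Fsq F) k x y = 2 * F x y * pdx F k x y := by
  have h := pdx_mul hU hF.slitSmooth hF.slitSmooth k hx hy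
  simp only [← sq] at h
  exact h.trans (by ring)

lemma pdy_Fsq (hU : IsOpen U) (hF : IsFinsler U F) (hx : x ∈ U) (hy : y ∈ slit n) (k : Fin n) :
    pdy (Fsq F) k x y = 2 * F x y * pdy F k x y := by
  have h := pdy_mul hU hF.slitSmooth hF.slitSmooth k hx hy
  simp only [← sq] at h
  exact h.trans (by ring)

lemma isUnit_det (hF : IsFinsler U F) (hx : x ∈ U) (hy : y ∈ slit n) :
    IsUnit (gmat F x y).det :=
  (hF.2.2.2 x hx y hy).det_pos.ne'.isUnit

lemma slitSmooth_gmat (hU : IsOpen U) (hF : IsFinsler U F) (i j : Fin n) :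
    SlitSmooth U (fun x y => gmat F x y i j) :=
  ((hF.slitSmooth_Fsq.pdy hU i).pdy hU j).const_mul _

lemma slitSmooth_lower (hU : IsOpen U) (hF : IsFinsler U F) (l : Fin n) :
    SlitSmooth U (fun x y => ∑ k, y k * pdy (pdx (Fsq F) k) l x y - pdx (Fsq F) l x y) :=
  (SlitSmooth.sum fun k _ => (SlitSmooth.coord k).mul
    ((hF.slitSmooth_Fsq.pdx hU k).pdy hU l)).sub (hF.slitSmooth_Fsq.pdx hU l)

lemma slitEuler_lower (hU : IsOpen U) (hF : IsFinsler U F) (l : Fin n) :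
    SlitEuler U 2 (fun x y => ∑ k, y k * pdy (pdx (Fsq F) k) l x y - pdx (Fsq F) l x y) := by
  have hs := hF.slitSmooth_Fsq
  have he := hF.slitEuler_Fsq hU
  have hterm : ∀ k, SlitEuler U 2 (fun x y => y k * pdy (pdx (Fsq F) k) l x y) := by
    intro k
    have := (SlitEuler.coord k).mul hU (SlitSmooth.coord k) ((hs.pdx hU k).pdy hU l)
      ((he.pdx hU hs k).pdy hU (hs.pdx hU k) l)
    norm_num at this
    exact this
  have hsm : ∀ k, SlitSmooth U (fun x y => y k * pdy (pdx (Fsq F) k) l x y) :=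
    fun k => (SlitSmooth.coord k).mul ((hs.pdx hU k).pdy hU l)
  exact (SlitEuler.sum hU (fun k _ => hsm k) fun k _ => hterm k).sub hU
    (SlitSmooth.sum fun k _ => hsm k) (hs.pdx hU l) (he.pdx hU hs l)

lemma slitSmooth_sprayF (hU : IsOpen U) (hF : IsFinsler U F) (i : Fin n) :
    SlitSmooth U (sprayF F i) :=
  (SlitSmooth.sum fun l _ => (SlitSmooth.inv_apply (hF.slitSmooth_gmat hU)
    (fun _ hx _ hy => (hF.isUnit_det hx hy).ne_zero) i l).mul (hF.slitSmooth_lower hU l)).const_mul _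

/-- The defining linear system `g_{il} G^l = ¼([F²]_{x^k y^i} y^k − [F²]_{x^i})` of the spray. -/
lemma gmat_mul_sprayF (hF : IsFinsler U F) (i : Fin n) : ∀ x ∈ U, ∀ y ∈ slit n,
    ∑ l, gmat F x y i l * sprayF F l x y =
      (1/4) * (∑ k, y k * pdy (pdx (Fsq F) k) i x y - pdx (Fsq F) i x y) := by
  intro x hx y hy
  set v : Fin n → ℝ := fun l => ∑ k, y k * pdy (pdx (Fsq F) k) l x y - pdx (Fsq F) l x y
  have hG : (fun l => sprayF F l x y) = (1/4 : ℝ) • (gmat F x y)⁻¹.mulVec v := rfl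
  have h : (gmat F x y).mulVec (fun l => sprayF F l x y) = (1/4 : ℝ) • v := by
    rw [hG, Matrix.mulVec_smul, Matrix.mulVec_mulVec,
      Matrix.mul_nonsing_inv _ (hF.isUnit_det hx hy), Matrix.one_mulVec]
  exact congrFun h i

lemma slitEuler_sprayF (hU : IsOpen U) (hF : IsFinsler U F) (i : Fin n) :
    SlitEuler U 2 (sprayF F i) := by
  intro x hx y hy
  have hG := hF.slitSmooth_sprayF hU
  have hs := hF.slitSmooth_Fsq
  have hge : ∀ i l, SlitEuler U 0 (fun x y => gmat F x y i l) := by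
    intro i l
    have h2 := ((hF.slitEuler_Fsq hU).pdy hU hs i).pdy hU (hs.pdy hU i) l
    norm_num at h2
    exact h2.const_mul hU _ ((hs.pdy hU i).pdy hU l)
  have hsys : (gmat F x y).mulVec (fun l => ∑ k, y k * pdy (sprayF F l) k x y)
      = (gmat F x y).mulVec (fun l => 2 * sprayF F l x y) := by
    ext a
    have h1 := (hF.slitEuler_lower hU a).const_mul hU (1/4) (hF.slitSmooth_lower hU a) x hx y hy
    simp only [← pdy_congr (hF.gmat_mul_sprayF a) _ x hx y hy, ← hF.gmat_mul_sprayF a x hx y hy,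
      pdy_sum hU (fun l _ => (hF.slitSmooth_gmat hU a l).mul (hG l)) _ hx hy,
      pdy_mul hU (hF.slitSmooth_gmat hU a _) (hG _) _ hx hy, Finset.sum_add_distrib, mul_add,
      Finset.mul_sum] at h1
    have h0 : ∑ k, ∑ l, y k * (pdy (fun x y => gmat F x y a l) k x y * sprayF F l x y) = 0 := by
      rw [Finset.sum_comm]
      refine Finset.sum_eq_zero fun l _ => ?_
      have := hge a l x hx y hy
      simp only [← mul_assoc, ← Finset.sum_mul, this]
      ring
    rw [h0, zero_add, Finset.sum_comm] at h1
    simp only [Matrix.mulVec, dotProduct, Finset.mul_sum]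
    calc _ = _ := Finset.sum_congr rfl fun l _ => Finset.sum_congr rfl fun k _ => by
          exact mul_left_comm _ _ _
      _ = _ := h1
      _ = _ := Finset.sum_congr rfl fun l _ => by ring
  exact congrFun (Matrix.mulVec_injective_of_isUnit
    ((Matrix.isUnit_iff_isUnit_det _).2 (hF.isUnit_det hx hy)) hsys) i

/-- `F²` is constant along the geodesic spray. -/
lemma sum_coord_mul_pdx_Fsq (hU : IsOpen U) (hF : IsFinsler U F) : ∀ x ∈ U, ∀ y ∈ slit n,
    ∑ k, y k * pdx (Fsq F) k x y = 2 * ∑ l, sprayF F l x y * pdy (Fsq F) l x y := by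
  intro x hx y hy
  have hs := hF.slitSmooth_Fsq
  have he := hF.slitEuler_Fsq hU
  have h1 : ∑ i, y i * ∑ l, gmat F x y i l * sprayF F l x y =
      ∑ i, y i * ((1/4) * (∑ k, y k * pdy (pdx (Fsq F) k) i x y - pdx (Fsq F) i x y)) :=
    Finset.sum_congr rfl fun i _ => by rw [hF.gmat_mul_sprayF i x hx y hy]
  have h2 : ∑ i, y i * ∑ l, gmat F x y i l * sprayF F l x y
      = (1/2) * ∑ l, sprayF F l x y * pdy (Fsq F) l x y := by
    simp only [Finset.mul_sum]
    rw [Finset.sum_comm]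
    refine Finset.sum_congr rfl fun l _ => ?_
    have := he.pdy hU hs l x hx y hy
    norm_num at this
    rw [← this]
    simp only [Finset.mul_sum]
    refine Finset.sum_congr rfl fun i _ => ?_
    rw [gmat, hs.pdy_pdy_comm hU hx hy i l]
    ring
  have h3 : ∑ i, y i * ∑ k, y k * pdy (pdx (Fsq F) k) i x y
      = 2 * ∑ k, y k * pdx (Fsq F) k x y := by
    simp only [Finset.mul_sum]
    rw [Finset.sum_comm]
    refine Finset.sum_congr rfl fun k _ => ?_
    have := he.pdx hU hs k x hx y hy
    rw [mul_left_comm, ← this, Finset.mul_sum]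
    exact Finset.sum_congr rfl fun i _ => by ring
  have h4 : ∑ i, y i * ((1/4) * (∑ k, y k * pdy (pdx (Fsq F) k) i x y - pdx (Fsq F) i x y))
      = (1/4) * (∑ i, y i * ∑ k, y k * pdy (pdx (Fsq F) k) i x y
        - ∑ i, y i * pdx (Fsq F) i x y) := by
    rw [← Finset.sum_sub_distrib, Finset.mul_sum]
    exact Finset.sum_congr rfl fun i _ => by ring
  rw [h2, h4, h3] at h1
  linarith

/-- `F²` is horizontally constant. -/
lemma pdx_Fsq_eq (hU : IsOpen U) (hF : IsFinsler U F) (k : Fin n) : ∀ x ∈ U, ∀ y ∈ slit n,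
    pdx (Fsq F) k x y = ∑ l, Nc (sprayF F) l k x y * pdy (Fsq F) l x y := by
  intro x hx y hy
  have hs := hF.slitSmooth_Fsq
  have hG := hF.slitSmooth_sprayF hU
  have h := pdy_congr (hF.sum_coord_mul_pdx_Fsq hU) k x hx y hy
  rw [pdy_sum_coord_mul hU (fun i => hs.pdx hU i) k hx hy,
    pdy_const_mul hU 2 (SlitSmooth.sum fun l _ => (hG l).mul (hs.pdy hU l)) k hx hy,
    pdy_sum hU (fun l _ => (hG l).mul (hs.pdy hU l)) k hx hy] at h
  simp only [pdy_mul hU (hG _) (hs.pdy hU _) k hx hy, Finset.sum_add_distrib] at h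
  have hsys := hF.gmat_mul_sprayF k x hx y hy
  have hg : ∑ l, gmat F x y k l * sprayF F l x y
      = (1/2) * ∑ l, sprayF F l x y * pdy (pdy (Fsq F) l) k x y := by
    rw [Finset.mul_sum]
    refine Finset.sum_congr rfl fun l _ => ?_
    rw [gmat, hs.pdy_pdy_comm hU hx hy k l]
    ring
  have hNc : ∑ l, pdy (sprayF F l) k x y * pdy (Fsq F) l x y
      = ∑ l, Nc (sprayF F) l k x y * pdy (Fsq F) l x y := rfl
  rw [hg] at hsys
  rw [hNc] at h
  linarith

lemma sum_coord_mul_pdx (hU : IsOpen U) (hF : IsFinsler U F) (hx : x ∈ U) (hy : y ∈ slit n) :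
    ∑ k, y k * pdx F k x y = 2 * ∑ l, sprayF F l x y * pdy F l x y := by
  have h := hF.sum_coord_mul_pdx_Fsq hU x hx y hy
  have hpos := hF.2.1 x hx y hy
  simp only [hF.pdx_Fsq hU hx hy, hF.pdy_Fsq hU hx hy, mul_left_comm _ (2 * F x y),
    ← Finset.mul_sum] at h
  refine mul_left_cancel₀ (mul_ne_zero two_ne_zero hpos.ne') ?_
  linarith

end IsFinsler

end Finsler

/-- Theorem 1.5: a Finsler metric of constant Ricci curvature and constant S-curvature
(w.r.t. the Busemann–Hausdorff volume form) has vanishing Berwald–Weyl curvature. -/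
theorem stmt_4 {n : ℕ} (hn : 2 ≤ n) (U : Set (Vec n)) (hU : IsOpen U) (hUne : U.Nonempty)
    (F : Vec n → Vec n → ℝ) (hF : IsFinsler U F) (c σ₀ : ℝ)
    (hS : ∀ x ∈ U, ∀ y ∈ slit n,
      Scurv (sprayF F) (sigmaBH F) x y = ((n : ℝ) + 1) * c * F x y)
    (hRic : ∀ x ∈ U, ∀ y ∈ slit n,
      ∑ m, Riem (sprayF F) m m x y = ((n : ℝ) - 1) * σ₀ * (F x y) ^ 2) :
    ∀ x ∈ U, ∀ y ∈ slit n, ∀ k : Fin n, BWeyl (sprayF F) (sigmaBH F) k x y = 0 := by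
  intro x hx y hy k
  have hn1 : (n : ℝ) - 1 ≠ 0 := by
    have : (2 : ℝ) ≤ n := by exact_mod_cast hn
    linarith
  have hn2 : (n : ℝ) + 1 ≠ 0 := by positivity
  have hG := hF.slitSmooth_sprayF hU
  have hGe := hF.slitEuler_sprayF hU
  have hFs := hF.slitSmooth
  set P : Vec n → Vec n → ℝ := fun x y => -c * F x y with hPdef
  have hP : SlitSmooth U P := hFs.const_mul _
  have hPe : SlitEuler U 1 P := (hF.slitEuler hU).const_mul hU _ hFs
  set h : Vec n → Vec n → ℝ := fun x y => (σ₀ + c ^ 2) * Fsq F x y with hhdef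
  have hh : SlitSmooth U h := hF.slitSmooth_Fsq.const_mul _
  have hhe : SlitEuler U 2 h := (hF.slitEuler_Fsq hU).const_mul hU _ hF.slitSmooth_Fsq
  have hGhat : ∀ i, ∀ x ∈ U, ∀ y ∈ slit n,
      Ghat (sprayF F) (sigmaBH F) i x y = projChange (sprayF F) P i x y := by
    intro i x hx y hy
    simp only [Ghat, projChange, hS x hx y hy, hPdef]
    field_simp
    ring
  have hR : ∀ x ∈ U, ∀ y ∈ slit n, Ricci (Ghat (sprayF F) (sigmaBH F)) x y = h x y := by
    intro x hx y hy
    have hspray : ∑ j, y j * pdx P j x y - 2 * ∑ j, sprayF F j x y * pdy P j x y = 0 := by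
      simp only [hPdef, pdx_const_mul hU _ hFs _ hx hy, pdy_const_mul hU _ hFs _ hx hy,
        mul_left_comm _ (-c), ← Finset.mul_sum, hF.sum_coord_mul_pdx hU hx hy]
      ring
    rw [Ricci, Finset.sum_congr rfl fun m _ => Riem_congr hU hGhat m m x hx y hy,
      sum_Riem_projChange hU hG hGe hP hPe hx hy, hRic x hx y hy, hspray]
    simp only [hPdef, hhdef, Fsq]
    field_simp
    ring
  have hpar : ∀ k, ∀ x ∈ U, ∀ y ∈ slit n,
      pdx h k x y = ∑ l, Nc (sprayF F) l k x y * pdy h l x y := by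
    intro k x hx y hy
    simp only [hhdef, pdx_const_mul hU _ hF.slitSmooth_Fsq _ hx hy,
      pdy_const_mul hU _ hF.slitSmooth_Fsq _ hx hy, hF.pdx_Fsq_eq hU k x hx y hy,
      mul_left_comm _ (σ₀ + c ^ 2), ← Finset.mul_sum]
  rw [BWeyl_eq_of_eqOn hU hGhat hR hx hy k,
    hD_sub_covD1_projChange hU hG hGe hP hPe hh hhe hpar hx hy k]
  simp only [hhdef, hPdef, pdy_const_mul hU _ hF.slitSmooth_Fsq _ hx hy,
    pdy_const_mul hU _ hFs _ hx hy, hF.pdy_Fsq hU hx hy]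
  rw [Fsq]
  ring

end BerwaldWeyl
end
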